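/- Let h and k be natural numbers with h ≥ 2 and k ≥ 3. Then there exist a natural number s with s ≤ (5/8)(k+1)² and natural numbers x_{iu} (1 ≤ i ≤ s, 1 ≤ u ≤ h) such that ∑_{i=1}^s x_{i1}^j = ∑_{i=1}^s x_{i2}^j = … = ∑_{i=1}^s x_{ih}^j for every j with 1 ≤ j ≤ k, while ∑_{i=1}^s x_{iu}^{k+1} ≠ ∑_{i=1}^s x_{iv}^{k+1} whenever 1 ≤ u < v ≤ h. In particular, W(k,h) ≤ (5/8)(k+1)², where W(k,h) is the least s for which such a configuration exists. -/

import Mathlib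

namespace TP
open Finset
noncomputable section

variable {Q : Type} [AddCommGroup Q]

/-- the polynomial phase -/
def Ph (k : ℕ) (q : ℕ → Q) (x : ℤ) : Q := ∑ j ∈ range (k + 1), x ^ j • q j

/-- Taylor frame -/
def fr (k : ℕ) (q : ℕ → Q) (x0 : ℤ) (i : ℕ) : Q :=
  ∑ j ∈ range (k + 1), ((j.choose i : ℤ) * x0 ^ (j - i)) • q j

def F (k : ℕ) (q : ℕ → Q) (X : ℤ → ℤ) (c : ℤ → ℂ) (S : Finset ℤ) (ψ : AddChar Q ℂ) : ℂ :=
  ∑ i ∈ S, c i * ψ (Ph k q (X i))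

def cl (X : ℤ → ℤ) (M r : ℕ) (S : Finset ℤ) : Finset ℤ :=
  S.filter (fun i => X i % (M : ℤ) = (r : ℤ))

def ND (k p M : ℕ) (q : ℕ → Q) : Prop :=
  ∀ n : ℕ → ℤ, ∑ j ∈ Icc 1 k, n j • q j = 0 → ∀ j ∈ Icc 1 k, (p : ℤ) ^ M ∣ n j

def Dec (k p N : ℕ) (D : ℝ) : Prop :=
  ∀ (Q : Type) [AddCommGroup Q] [Finite Q] (q : ℕ → Q), ND k p (k * N) q →
    ∀ (S : Finset ℤ) (X : ℤ → ℤ) (c : ℤ → ℂ),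
      ∑ ψ : AddChar Q ℂ, ‖F k q X c S ψ‖ ^ (k * (k + 1)) ≤
        D * ∑ r ∈ range (p ^ N), ∑ ψ : AddChar Q ℂ, ‖F k q X c (cl X (p ^ N) r S) ψ‖ ^ (k * (k + 1))

lemma Ph_taylor (k : ℕ) (q : ℕ → Q) (x0 y : ℤ) :
    Ph k q (x0 + y) = ∑ i ∈ range (k + 1), y ^ i • fr k q x0 i := by
  unfold Ph fr
  simp_rw [smul_sum, smul_smul]
  rw [sum_comm]
  refine sum_congr rfl fun j hj => ?_
  rw [← sum_smul]
  congr 1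
  rw [add_comm, add_pow]
  have hj' : j + 1 ≤ k + 1 := by simpa [mem_range] using hj
  rw [← sum_subset (range_subset_range.2 hj')]
  · refine sum_congr rfl fun i _ => by ring
  · intro i _ hi
    rw [Nat.choose_eq_zero_of_lt (by simpa [Nat.lt_succ_iff] using hi)]
    simp

lemma Ph_scale (k : ℕ) (q : ℕ → Q) (x0 P y : ℤ) :
    Ph k q (x0 + P * y) = Ph k (fun i => P ^ i • fr k q x0 i) y := by
  rw [Ph_taylor]
  unfold Ph
  refine sum_congr rfl fun i _ => ?_
  rw [smul_smul, mul_pow, mul_comm]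

lemma sum_fr (k l : ℕ) (q : ℕ → Q) (x0 : ℤ) (n : ℕ → ℤ) :
    ∑ i ∈ Icc 1 l, n i • fr k q x0 i =
      ∑ j ∈ Icc 1 k, (∑ i ∈ Icc 1 l, n i * ((j.choose i : ℤ) * x0 ^ (j - i))) • q j := by
  unfold fr
  simp_rw [smul_sum, smul_smul]
  rw [sum_comm]
  simp_rw [← sum_smul]
  symm
  apply sum_subset
  · intro j hj; simp at hj ⊢; omega
  · intro j hj hj'
    have : j = 0 := by simp at hj hj'; omega
    subst this
    rw [sum_eq_zero, zero_smul]
    intro i hi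
    rw [Nat.choose_eq_zero_of_lt (by simp at hi; omega)]
    simp

lemma ND_fr {k p M : ℕ} {q : ℕ → Q} (h : ND k p M q) (x0 : ℤ) : ND k p M (fr k q x0) := by
  intro n hn
  rw [sum_fr] at hn
  have h2 := h _ hn
  intro j
  induction j using Nat.strong_induction_on with
  | _ j ih =>
    intro hj
    have h3 := h2 j hj
    rw [← Finset.add_sum_erase _ _ hj] at h3
    simp only [Nat.choose_self, Nat.sub_self, pow_zero, mul_one, Nat.cast_one] at h3
    refine (Int.dvd_add_left ?_).1 h3
    apply dvd_sum
    intro i hi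
    simp only [mem_erase, mem_Icc] at hi
    rcases lt_or_gt_of_ne hi.1 with h4 | h4
    · exact (ih i h4 (by simp; omega)).mul_right _
    · rw [Nat.choose_eq_zero_of_lt h4]; simp

lemma ND_scale {k p N : ℕ} (hp : p ≠ 0) {q : ℕ → Q} {b : ℕ} (h : ND k p (k * (b + N)) q) :
    ND k p (k * N) (fun i => ((p : ℤ) ^ b) ^ i • q i) := by
  intro n hn j hj
  simp_rw [smul_smul] at hn
  have h2 := h _ hn j hj
  have hj' : j ≤ k := by simp at hj; omega
  have : (p : ℤ) ^ (k * (b + N)) = p ^ (k * N) * p ^ ((k - j) * b) * (p ^ b) ^ j := by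
    rw [← pow_mul, ← pow_add, ← pow_add]
    congr 1
    obtain ⟨d, rfl⟩ := Nat.exists_eq_add_of_le hj'
    simp; ring
  rw [this] at h2
  have h3 := Int.dvd_of_mul_dvd_mul_right (by positivity) h2
  exact dvd_of_mul_right_dvd h3

lemma cl_cl (X : ℤ → ℤ) (A B r t : ℕ) (hA : 0 < A) (hr : r < A) (S : Finset ℤ) :
    cl (fun i => X i / (A : ℤ)) B t (cl X A r S) = cl X (A * B) (r + A * t) S := by
  unfold cl
  rw [filter_filter]
  refine filter_congr fun i _ => ?_
  have h1 : X i % ((A * B : ℕ) : ℤ) = X i % A + A * (X i / A % B) := by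
    push_cast
    have := Int.emod_add_mul_ediv (X i) A
    have h5 := Int.emod_add_mul_ediv (X i / A) B
    have hAB : X i / ((A : ℤ) * B) = X i / A / B := by
      rw [Int.ediv_ediv_of_nonneg (by positivity)]
    have h6 := Int.emod_add_mul_ediv (X i) (A * B)
    rw [hAB] at h6
    linear_combination h6 - this - (A : ℤ) * h5
  rw [h1]
  push_cast
  constructor
  · rintro ⟨h2, h3⟩; rw [h2, h3]
  · intro h2
    have hA' : (0 : ℤ) < A := by exact_mod_cast hA
    have h3 := Int.emod_nonneg (X i) hA'.ne'
    have h4 := Int.emod_lt_of_pos (X i) hA'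
    have hr' : (r : ℤ) < A := by exact_mod_cast hr
    have h5 : X i % A = r := by
      have := congrArg (· % (A : ℤ)) h2
      simp only [Int.add_mul_emod_self_left] at this
      rwa [Int.emod_emod, Int.emod_eq_of_lt (by positivity) hr'] at this
    refine ⟨h5, ?_⟩
    rw [h5] at h2
    have := add_left_cancel h2
    exact mul_left_cancel₀ hA'.ne' this

lemma mem_cl {X : ℤ → ℤ} {A r : ℕ} {S : Finset ℤ} {i : ℤ} (h : i ∈ cl X A r S) :
    X i = r + A * (X i / A) := by
  have := (mem_filter.1 h).2
  rw [← this]; exact (Int.emod_add_mul_ediv (X i) A).symm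

lemma F_scale (k : ℕ) (q : ℕ → Q) (X : ℤ → ℤ) (c : ℤ → ℂ) (A r : ℕ) (S T : Finset ℤ)
    (hT : T ⊆ cl X A r S) (ψ : AddChar Q ℂ) :
    F k q X c T ψ =
      F k (fun i => (A : ℤ) ^ i • fr k q r i) (fun i => X i / (A : ℤ)) c T ψ := by
  unfold F
  refine sum_congr rfl fun i hi => ?_
  rw [← Ph_scale, ← mem_cl (hT hi)]

lemma cl_subset (X : ℤ → ℤ) (A r : ℕ) (S : Finset ℤ) : cl X A r S ⊆ S := filter_subset _ _

lemma cl_sub_cl (X : ℤ → ℤ) (A B r t : ℕ) (hA : 0 < A) (hr : r < A) (S : Finset ℤ) :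
    cl X (A * B) (r + A * t) S ⊆ cl X A r S := by
  rw [← cl_cl X A B r t hA hr]; exact cl_subset _ _ _ _

lemma dec_scale {k p m : ℕ} {D : ℝ} (hD : Dec k p m D) (hp : 0 < p) [Finite Q] {q : ℕ → Q} {b : ℕ}
    (hq : ND k p (k * (b + m)) q) (S : Finset ℤ) (X : ℤ → ℤ) (c : ℤ → ℂ) (r : ℕ) (hr : r < p ^ b) :
    ∑ ψ : AddChar Q ℂ, ‖F k q X c (cl X (p ^ b) r S) ψ‖ ^ (k * (k + 1)) ≤
      D * ∑ t ∈ range (p ^ m), ∑ ψ : AddChar Q ℂ,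
        ‖F k q X c (cl X (p ^ (b + m)) (r + p ^ b * t) S) ψ‖ ^ (k * (k + 1)) := by
  have hpb : 0 < p ^ b := by positivity
  have h1 : ND k p (k * m) (fun i => ((p ^ b : ℕ) : ℤ) ^ i • fr k q r i) := by
    push_cast
    exact ND_scale hp.ne' (ND_fr hq r)
  have h2 := hD Q _ h1 (cl X (p ^ b) r S) (fun i => X i / ((p ^ b : ℕ) : ℤ)) c
  simp_rw [cl_cl X (p ^ b) (p ^ m) r _ hpb hr] at h2
  rw [pow_add]
  have e1 : ∀ ψ, F k q X c (cl X (p ^ b) r S) ψ = _ :=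
    fun ψ => F_scale k q X c (p ^ b) r S _ (Subset.refl _) ψ
  have e2 : ∀ t ψ, F k q X c (cl X (p ^ b * p ^ m) (r + p ^ b * t) S) ψ = _ :=
    fun t ψ => F_scale k q X c (p ^ b) r S _ (cl_sub_cl _ _ _ _ _ hpb hr _) ψ
  simp only [e1, e2]
  exact h2

lemma sum_range_mul (A B : ℕ) (g : ℕ → ℝ) :
    ∑ r ∈ range (A * B), g r = ∑ r ∈ range A, ∑ t ∈ range B, g (r + A * t) := by
  rw [sum_comm]
  induction B with
  | zero => simp
  | succ B ih =>
    rw [Nat.mul_succ, sum_range_add, ih, sum_range_succ]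
    congr 1
    refine sum_congr rfl fun i _ => by rw [add_comm]

lemma dec_scale_sum {k p m : ℕ} {D : ℝ} (hD : Dec k p m D) (hp : 0 < p) [Finite Q] {q : ℕ → Q}
    {b : ℕ}
    (hq : ND k p (k * (b + m)) q) (S : Finset ℤ) (X : ℤ → ℤ) (c : ℤ → ℂ) :
    ∑ r ∈ range (p ^ b), ∑ ψ : AddChar Q ℂ, ‖F k q X c (cl X (p ^ b) r S) ψ‖ ^ (k * (k + 1)) ≤
      D * ∑ t ∈ range (p ^ (b + m)), ∑ ψ : AddChar Q ℂ,
        ‖F k q X c (cl X (p ^ (b + m)) t S) ψ‖ ^ (k * (k + 1)) := by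
  conv_rhs => rw [show range (p ^ (b + m)) = range (p ^ b * p ^ m) by rw [pow_add]]
  rw [sum_range_mul, mul_sum]
  refine sum_le_sum fun r hr => dec_scale hD hp hq S X c r (mem_range.1 hr)

lemma F_split (k : ℕ) (q : ℕ → Q) (X : ℤ → ℤ) (c : ℤ → ℂ) (M : ℕ) (hM : 0 < M) (S : Finset ℤ)
    (ψ : AddChar Q ℂ) :
    F k q X c S ψ = ∑ r ∈ range M, F k q X c (cl X M r S) ψ := by
  unfold F cl
  have hM' : (0 : ℤ) < M := by exact_mod_cast hM
  rw [← sum_fiberwise_of_maps_to (s := S) (t := range M) (g := fun i => (X i % (M : ℤ)).toNat)]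
  · refine sum_congr rfl fun r _ => sum_congr ?_ fun _ _ => rfl
    refine filter_congr fun i _ => ?_
    have := Int.emod_nonneg (X i) hM'.ne'
    omega
  · intro i _
    have := Int.emod_nonneg (X i) hM'.ne'
    have := Int.emod_lt_of_pos (X i) hM'
    simp; omega

lemma F_split' (k : ℕ) (q : ℕ → Q) (X : ℤ → ℤ) (c : ℤ → ℂ) (A B : ℕ) (hA : 0 < A) (hB : 0 < B)
    (r : ℕ) (hr : r < A) (S : Finset ℤ) (ψ : AddChar Q ℂ) :
    F k q X c (cl X A r S) ψ = ∑ t ∈ range B, F k q X c (cl X (A * B) (r + A * t) S) ψ := by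
  rw [F_scale k q X c A r S _ (Subset.refl _), F_split _ _ _ _ B hB]
  refine sum_congr rfl fun t _ => ?_
  rw [cl_cl _ _ _ _ _ hA hr]
  exact (F_scale k q X c _ r S _ (cl_sub_cl _ _ _ _ _ hA hr _) _).symm

end
end TP

namespace TP
open Finset
noncomputable section

variable {Q : Type} [AddCommGroup Q]

lemma matrix_field {p k l : ℕ} [Fact p.Prime] (hk : k < p) (hl : l ≤ k) (z : ZMod p) (hz : z ≠ 0)
    (N : ℕ → ZMod p)
    (h : ∀ j ∈ Icc (k - l + 1) k, ∑ i ∈ Icc 1 l, N i * ((j.choose i : ZMod p) * z ^ (j - i)) = 0) :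
    ∀ i ∈ Icc 1 l, N i = 0 := by
  classical
  set m : ℕ → ZMod p := fun i => N i * (z⁻¹) ^ i with hm
  set P : Polynomial (ZMod p) :=
    ∑ i ∈ Icc 1 l, Polynomial.C (m i * ((i.factorial : ZMod p))⁻¹) * descPochhammer (ZMod p) i with hP
  have hfac : ∀ i, i ≤ k → ((i.factorial : ℕ) : ZMod p) ≠ 0 := by
    intro i hi h0
    rw [ZMod.natCast_eq_zero_iff, (Fact.out : p.Prime).dvd_factorial] at h0
    omega
  have heval : ∀ j : ℕ, P.eval (j : ZMod p) = ∑ i ∈ Icc 1 l, m i * (j.choose i : ZMod p) := by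
    intro j
    rw [hP, Polynomial.eval_finsetSum]
    refine sum_congr rfl fun i hi => ?_
    rw [Polynomial.eval_mul, Polynomial.eval_C, descPochhammer_eval_eq_descFactorial,
      Nat.descFactorial_eq_factorial_mul_choose]
    have := hfac i (by simp at hi; omega)
    push_cast
    field_simp
  have hroot : ∀ j ∈ Icc (k - l + 1) k, P.eval (j : ZMod p) = 0 := by
    intro j hj
    rw [heval]
    have h1 := h j hj
    have h2 : z ^ j * ∑ i ∈ Icc 1 l, m i * (j.choose i : ZMod p) = 0 := by
      rw [← h1, mul_sum]
      refine sum_congr rfl fun i hi => ?_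
      rcases le_or_gt i j with h3 | h3
      · obtain ⟨d, rfl⟩ := Nat.exists_eq_add_of_le h3
        simp only [hm, Nat.add_sub_cancel_left]
        rw [pow_add, inv_pow]
        field_simp
      · rw [Nat.choose_eq_zero_of_lt h3]; simp
    exact (mul_eq_zero.1 h2).resolve_left (pow_ne_zero _ hz)
  have hroot0 : P.eval ((0 : ℕ) : ZMod p) = 0 := by
    rw [heval]
    refine sum_eq_zero fun i hi => ?_
    rw [Nat.choose_eq_zero_of_lt (by simp at hi; omega)]; simp
  have hP0 : P = 0 := by
    have hinj : Set.InjOn (fun j : ℕ => (j : ZMod p)) (insert 0 (Icc (k - l + 1) k) : Finset ℕ) := by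
      intro x hx y hy hxy
      have hx' : x < p := by simp at hx; omega
      have hy' : y < p := by simp at hy; omega
      have := (ZMod.natCast_eq_natCast_iff' x y p).1 hxy
      rwa [Nat.mod_eq_of_lt hx', Nat.mod_eq_of_lt hy'] at this
    refine Polynomial.eq_zero_of_natDegree_lt_card_of_eval_eq_zero' P
      ((insert 0 (Icc (k - l + 1) k)).image (fun j : ℕ => (j : ZMod p))) ?_ ?_
    · intro x hx
      simp only [mem_image, mem_insert] at hx
      obtain ⟨j, hj, rfl⟩ := hx
      rcases hj with rfl | hj
      · exact hroot0
      · exact hroot j hj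
    · rw [card_image_of_injOn hinj, card_insert_of_notMem (by simp)]
      simp only [Nat.card_Icc]
      have : P.natDegree ≤ l := by
        rw [hP]
        refine Polynomial.natDegree_sum_le_of_forall_le _ _ fun i hi => ?_
        refine (Polynomial.natDegree_C_mul_le _ _).trans ?_
        rw [descPochhammer_natDegree]
        simp at hi; omega
      omega
  have key : ∀ j : ℕ, j ∈ Icc 1 l → m j = 0 := by
    intro j
    induction j using Nat.strong_induction_on with
    | _ j ih =>
      intro hj
      have h3 := heval j
      rw [hP0, Polynomial.eval_zero, ← Finset.add_sum_erase _ _ hj, sum_eq_zero (s := (Icc 1 l).erase j)] at h3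
      · simpa using h3.symm
      · intro i hi
        simp only [mem_erase] at hi
        rcases lt_or_gt_of_ne hi.1 with h4 | h4
        · rw [ih i h4 hi.2]; simp
        · rw [Nat.choose_eq_zero_of_lt h4]; simp
  intro i hi
  exact (mul_eq_zero.1 (key i hi)).resolve_right (pow_ne_zero _ (inv_ne_zero hz))

lemma matrix_lemma {p k l : ℕ} (hp : p.Prime) (hk : k < p) (hl : l ≤ k) (z : ℤ)
    (hz : ¬ (p : ℤ) ∣ z) (μ : ℕ) : ∀ (N : ℕ → ℤ)
    (_ : ∀ j ∈ Icc (k - l + 1) k,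
      (p : ℤ) ^ μ ∣ ∑ i ∈ Icc 1 l, N i * ((j.choose i : ℤ) * z ^ (j - i))),
    ∀ i ∈ Icc 1 l, (p : ℤ) ^ μ ∣ N i := by
  have : Fact p.Prime := ⟨hp⟩
  induction μ with
  | zero => intro N _ i _; simp
  | succ μ ih =>
    intro N h
    have h1 : ∀ i ∈ Icc 1 l, (p : ℤ) ∣ N i := by
      have := matrix_field hk hl (z : ZMod p)
        (by rwa [Ne, ZMod.intCast_zmod_eq_zero_iff_dvd]) (fun i => (N i : ZMod p)) ?_
      · intro i hi
        exact (ZMod.intCast_zmod_eq_zero_iff_dvd _ _).1 (this i hi)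
      · intro j hj
        have h2 : (p : ℤ) ∣ _ := dvd_trans (dvd_pow_self _ (by omega)) (h j hj)
        have h3 := (ZMod.intCast_zmod_eq_zero_iff_dvd _ _).2 h2
        push_cast at h3
        exact h3
    have hp0 : (p : ℤ) ≠ 0 := by exact_mod_cast hp.ne_zero
    have h2 := ih (fun i => N i / p) ?_
    · intro i hi
      obtain ⟨d, hd⟩ := h1 i hi
      have := h2 i hi
      simp only [hd, Int.mul_ediv_cancel_left _ hp0] at this
      rw [hd, pow_succ, mul_comm]
      exact mul_dvd_mul_left _ this
    · intro j hj
      have h3 := h j hj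
      have h4 : ∑ i ∈ Icc 1 l, N i * ((j.choose i : ℤ) * z ^ (j - i)) =
          p * ∑ i ∈ Icc 1 l, (N i / p) * ((j.choose i : ℤ) * z ^ (j - i)) := by
        rw [mul_sum]
        refine sum_congr rfl fun i hi => ?_
        rw [← mul_assoc (p : ℤ), Int.mul_ediv_cancel' (h1 i hi)]
      rw [h4, pow_succ, mul_comm] at h3
      exact Int.dvd_of_mul_dvd_mul_left (by omega) h3

/-- averaging over characters of a quotient -/
lemma avg [Finite Q] (R : AddSubgroup Q) (A B : AddChar Q ℂ → ℝ) (D : ℝ)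
    (h : ∀ ψ : AddChar Q ℂ,
      ∑ χ : AddChar (Q ⧸ R) ℂ, A (ψ * χ.compAddMonoidHom (QuotientAddGroup.mk' R)) ≤
      D * ∑ χ : AddChar (Q ⧸ R) ℂ, B (ψ * χ.compAddMonoidHom (QuotientAddGroup.mk' R))) :
    ∑ ψ, A ψ ≤ D * ∑ ψ, B ψ := by
  have key : ∀ G : AddChar Q ℂ → ℝ, ∑ ψ : AddChar Q ℂ, ∑ χ : AddChar (Q ⧸ R) ℂ,
      G (ψ * χ.compAddMonoidHom (QuotientAddGroup.mk' R)) =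
      (Fintype.card (AddChar (Q ⧸ R) ℂ) : ℝ) * ∑ ψ, G ψ := by
    intro G
    rw [sum_comm]
    have : ∀ χ : AddChar (Q ⧸ R) ℂ,
        ∑ ψ : AddChar Q ℂ, G (ψ * χ.compAddMonoidHom (QuotientAddGroup.mk' R)) = ∑ ψ, G ψ :=
      fun χ => Equiv.sum_comp (Equiv.mulRight (χ.compAddMonoidHom (QuotientAddGroup.mk' R))) G
    simp_rw [this]
    simp
  have h1 := sum_le_sum fun ψ (_ : ψ ∈ (univ : Finset (AddChar Q ℂ))) => h ψ
  rw [← mul_sum, key, key] at h1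
  have hc : (0 : ℝ) < Fintype.card (AddChar (Q ⧸ R) ℂ) := by
    exact_mod_cast Fintype.card_pos
  rw [mul_left_comm] at h1
  exact le_of_mul_le_mul_left h1 hc

/-- subgroup used in the step -/
def RS (k l P : ℕ) (w : ℕ → Q) : AddSubgroup Q where
  carrier := {y | ∃ m : ℕ → ℤ, (∀ j ∈ Icc (k - l + 1) k, (P : ℤ) ∣ m j) ∧
    y = ∑ j ∈ Icc 1 k, m j • w j}
  zero_mem' := ⟨0, by simp, by simp⟩
  add_mem' := by
    rintro _ _ ⟨m, hm, rfl⟩ ⟨m', hm', rfl⟩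
    exact ⟨m + m', fun j hj => dvd_add (hm j hj) (hm' j hj), by
      simp [add_smul, sum_add_distrib]⟩
  neg_mem' := by
    rintro _ ⟨m, hm, rfl⟩
    exact ⟨-m, fun j hj => (hm j hj).neg_right, by simp [neg_smul]⟩

lemma RS_mem_single {k l P : ℕ} (w : ℕ → Q) (e : ℤ) (j : ℕ) (hj : j ∈ Icc 1 k)
    (h : k - l + 1 ≤ j → (P : ℤ) ∣ e) : e • w j ∈ RS k l P w := by
  refine ⟨fun i => if i = j then e else 0, ?_, ?_⟩
  · intro i hi
    simp only [mem_Icc] at hi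
    dsimp only
    split_ifs with h1
    · exact h (by omega)
    · simp
  · simp only [ite_smul, zero_smul]
    rw [sum_ite_eq' , if_pos hj]

lemma RS_P {k l P : ℕ} (w : ℕ → Q) (z : ℤ) (i : ℕ) (hi : 1 ≤ i) (e : ℤ) (he : (P : ℤ) ∣ e) :
    e • fr k w z i ∈ RS k l P w := by
  unfold fr
  rw [smul_sum]
  refine sum_mem fun j hj => ?_
  rw [smul_smul]
  rcases Nat.eq_zero_or_pos j with rfl | h
  · rw [Nat.choose_eq_zero_of_lt (by omega)]
    simp
  · exact RS_mem_single w _ j (by simp at hj ⊢; omega) fun _ => he.mul_right _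

theorem step {k l p n N a b : ℕ} {D : ℝ} (hp : p.Prime) (hkp : k < p) (hl1 : 1 ≤ l) (hlk : l < k)
    (hD : Dec l p n D) [Finite Q] {q : ℕ → Q} (hq : ND k p (k * N) q)
    (ha : l * n ≤ a) (hab : l * (a + n) ≤ (k - l + 1) * b) (haN : a + n ≤ N)
    (r r' : ℕ) (hr : r < p ^ a) (hrr : ¬ (p : ℤ) ∣ (r : ℤ) - r')
    (S : Finset ℤ) (X : ℤ → ℤ) (c : ℤ → ℂ) (v : ℕ) :
    ∑ ψ : AddChar Q ℂ, ‖F k q X c (cl X (p ^ a) r S) ψ‖ ^ (l * (l + 1)) *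
        ‖F k q X c (cl X (p ^ b) r' S) ψ‖ ^ v ≤
      D * ∑ ψ : AddChar Q ℂ, ∑ t ∈ range (p ^ n),
        ‖F k q X c (cl X (p ^ (a + n)) (r + p ^ a * t) S) ψ‖ ^ (l * (l + 1)) *
        ‖F k q X c (cl X (p ^ b) r' S) ψ‖ ^ v := by
  have hppos := hp.pos
  have hpa : 0 < p ^ a := by positivity
  set w := fr k q r' with hw
  set z : ℤ := (r : ℤ) - r' with hz
  set μ := l * (a + n) with hμ
  set R := RS k l (p ^ μ) w with hR
  have hndw : ND k p (k * N) w := ND_fr hq r'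
  refine avg R _ _ D fun ψ => ?_
  -- invariance of the second factor
  have hB : ∀ χ : AddChar (Q ⧸ R) ℂ,
      ‖F k q X c (cl X (p ^ b) r' S) (ψ * χ.compAddMonoidHom (QuotientAddGroup.mk' R))‖ =
      ‖F k q X c (cl X (p ^ b) r' S) ψ‖ := by
    intro χ
    have : F k q X c (cl X (p ^ b) r' S) (ψ * χ.compAddMonoidHom (QuotientAddGroup.mk' R)) =
        F k q X c (cl X (p ^ b) r' S) ψ * χ (QuotientAddGroup.mk' R (w 0)) := by
      unfold F
      rw [sum_mul]
      refine sum_congr rfl fun i hi => ?_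
      rw [AddChar.mul_apply, AddChar.compAddMonoidHom_apply, mul_assoc]
      congr 3
      rw [mem_cl hi, Ph_taylor]
      rw [sum_range_succ', pow_zero, one_smul, map_add, add_eq_right]
      refine (QuotientAddGroup.eq_zero_iff _).2 ?_
      refine sum_mem fun j hj => ?_
      refine RS_mem_single w _ (j + 1) (by simp at hj ⊢; omega) fun h1 => ?_
      push_cast
      rw [mul_pow, ← pow_mul]
      refine Dvd.dvd.mul_right (pow_dvd_pow _ ?_) _
      calc μ ≤ (k - l + 1) * b := hab
        _ ≤ (j + 1) * b := Nat.mul_le_mul_right _ h1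
        _ = b * (j + 1) := mul_comm _ _
    rw [this, norm_mul, AddChar.norm_apply, mul_one]
  -- first factor
  set qt : ℕ → Q ⧸ R := fun i => ((p ^ a : ℕ) : ℤ) ^ i • (QuotientAddGroup.mk' R (fr k w z i)) with hqt
  set X' : ℤ → ℤ := fun i => X i / ((p ^ a : ℕ) : ℤ) with hX'
  set c' : ℤ → ℂ := fun i => c i * ψ (Ph k q (X i)) with hc'
  have hA : ∀ χ : AddChar (Q ⧸ R) ℂ, ∀ T ⊆ cl X (p ^ a) r S,
      F k q X c T (ψ * χ.compAddMonoidHom (QuotientAddGroup.mk' R)) = F l qt X' c' T χ := by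
    intro χ T hT
    unfold F
    refine sum_congr rfl fun i hi => ?_
    rw [AddChar.mul_apply, AddChar.compAddMonoidHom_apply, ← mul_assoc]
    congr 2
    have h1 : X i = r' + (z + ((p ^ a : ℕ) : ℤ) * X' i) := by
      rw [hz]; have := mem_cl (hT hi); rw [hX']; linarith
    have h2 : Ph k q (X i) = Ph k w (z + ((p ^ a : ℕ) : ℤ) * X' i) := by
      conv_lhs => rw [h1]
      rw [Ph_taylor]; rfl
    rw [h2, Ph_scale]
    unfold Ph
    rw [map_sum]
    symm
    have hsub : range (l + 1) ⊆ range (k + 1) := range_subset_range.2 (by omega)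
    rw [← sum_subset hsub]
    · refine sum_congr rfl fun j _ => ?_
      rw [map_zsmul, map_zsmul]
    · intro j _ hj
      have hj : l + 1 ≤ j := by simpa using hj
      refine (QuotientAddGroup.eq_zero_iff _).2 ?_
      rw [smul_smul]
      refine RS_P w z j (by omega) _ (Dvd.dvd.mul_left ?_ _)
      push_cast
      rw [← pow_mul]
      refine pow_dvd_pow _ ?_
      calc μ = a * l + l * n := by rw [hμ]; ring
        _ ≤ a * l + a := by omega
        _ = a * (l + 1) := by ring
        _ ≤ a * j := Nat.mul_le_mul_left _ hj
  have hndt : ND l p (l * n) qt := by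
    intro m hm i hi
    have h1 : ∑ i ∈ Icc 1 l, (m i * ((p ^ a : ℕ) : ℤ) ^ i) • fr k w z i ∈ R := by
      refine (QuotientAddGroup.eq_zero_iff _).1 ?_
      have : QuotientAddGroup.mk' R (∑ i ∈ Icc 1 l, (m i * ((p ^ a : ℕ) : ℤ) ^ i) • fr k w z i) = 0 := by
        rw [map_sum, ← hm]
        refine sum_congr rfl fun i _ => ?_
        rw [hqt, map_zsmul, mul_smul]
      exact this
    obtain ⟨m', hm', h2⟩ := h1
    rw [sum_fr, ← sub_eq_zero, ← sum_sub_distrib] at h2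
    simp_rw [← sub_smul] at h2
    have h3 := hndw _ h2
    have h4 := matrix_lemma hp hkp hlk.le z hrr μ (fun i => m i * ((p ^ a : ℕ) : ℤ) ^ i) ?_ i hi
    · simp only [mem_Icc] at hi
      push_cast at h4
      rw [← pow_mul] at h4
      have h5 : (p : ℤ) ^ μ = p ^ (l * n) * p ^ (a * (l - i)) * p ^ (a * i) := by
        rw [← pow_add, ← pow_add]
        congr 1
        obtain ⟨d, hd⟩ := Nat.exists_eq_add_of_le hi.2
        rw [hμ, hd]; simp; ring
      rw [h5] at h4
      exact dvd_of_mul_right_dvd (Int.dvd_of_mul_dvd_mul_right (by positivity) h4)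
    · intro j hj
      have hj1 : j ∈ Icc 1 k := by simp at hj ⊢; omega
      have h5 := h3 j hj1
      have h6 : (p : ℤ) ^ μ ∣ p ^ (k * N) := by
        refine pow_dvd_pow _ ?_
        calc μ ≤ l * N := Nat.mul_le_mul_left _ haN
          _ ≤ k * N := Nat.mul_le_mul_right _ hlk.le
      have h7 := dvd_trans h6 h5
      have h8 := hm' j hj
      push_cast at h8
      have := dvd_add h7 h8
      simpa using this
  have h1 := hD (Q ⧸ R) qt hndt (cl X (p ^ a) r S) X' c'
  simp_rw [hB]
  simp_rw [hX', cl_cl X (p ^ a) (p ^ n) r _ hpa hr] at h1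
  simp only [hA _ _ (Subset.refl _)]
  rw [← sum_mul]
  refine (mul_le_mul_of_nonneg_right h1 (by positivity)).trans (le_of_eq ?_)
  rw [mul_assoc, sum_comm, sum_mul]
  congr 1
  refine sum_congr rfl fun χ _ => ?_
  rw [sum_mul]
  refine sum_congr rfl fun t _ => ?_
  rw [pow_add, hA _ _ (cl_sub_cl X _ _ _ _ hpa hr _)]

end
end TP

namespace TP
open Finset
noncomputable section

def V {Ψ : Type} [Fintype Ψ] (f : ℕ → ℕ → Ψ → ℝ) (p k l a b : ℕ) : ℝ :=
  ∑ r ∈ range (p ^ a), ∑ r' ∈ range (p ^ b), if (p : ℤ) ∣ (r : ℤ) - r' then 0 else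
    ∑ ψ, f a r ψ ^ (l * (l + 1)) * f b r' ψ ^ (k * (k + 1) - l * (l + 1))

def sg (l : ℕ) : ℝ := (l : ℝ) * (l + 1) / 2

lemma young {x y : ℝ} (hx : 0 ≤ x) (hy : 0 ≤ y) {u v u1 v1 u2 v2 : ℕ} {α β : ℝ} (hα : 0 ≤ α)
    (hβ : 0 ≤ β) (hαβ : α + β = 1) (hu : (u : ℝ) = α * u1 + β * u2)
    (hv : (v : ℝ) = α * v1 + β * v2) {A B : ℝ} (hA : 0 < A) (hB : 0 < B) :
    x ^ u * y ^ v ≤ A ^ α * B ^ β * (α * (x ^ u1 * y ^ v1 / A) + β * (x ^ u2 * y ^ v2 / B)) := by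
  have key : ∀ {t : ℝ} (_ : 0 ≤ t) {w w1 w2 : ℕ} (_ : (w : ℝ) = α * w1 + β * w2),
      t ^ w = (t ^ w1) ^ α * (t ^ w2) ^ β := by
    intro t ht w w1 w2 hw
    rw [← Real.rpow_natCast t w, hw, Real.rpow_add_of_nonneg ht (by positivity) (by positivity),
      ← Real.rpow_natCast t w1, ← Real.rpow_natCast t w2, ← Real.rpow_mul ht, ← Real.rpow_mul ht,
      mul_comm α, mul_comm β]
  have h1 := Real.geom_mean_le_arith_mean2_weighted hα hβ
    (p₁ := x ^ u1 * y ^ v1 / A) (p₂ := x ^ u2 * y ^ v2 / B) (by positivity) (by positivity) hαβ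
  have h2 := mul_le_mul_of_nonneg_left h1 (by positivity : 0 ≤ A ^ α * B ^ β)
  refine le_trans (le_of_eq ?_) h2
  rw [Real.div_rpow (by positivity) hA.le, Real.div_rpow (by positivity) hB.le,
    Real.mul_rpow (by positivity) (by positivity), Real.mul_rpow (by positivity) (by positivity),
    key hx hu, key hy hv]
  have := (Real.rpow_pos_of_pos hA α).ne'
  have := (Real.rpow_pos_of_pos hB β).ne'
  field_simp

variable {Ψ : Type} [Fintype Ψ] {f : ℕ → ℕ → Ψ → ℝ}

lemma V_nonneg (hf : ∀ a r ψ, 0 ≤ f a r ψ) (p k l a b : ℕ) : 0 ≤ V f p k l a b := by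
  unfold V
  refine sum_nonneg fun r _ => sum_nonneg fun r' _ => ?_
  split_ifs
  · exact le_rfl
  · exact sum_nonneg fun ψ _ => mul_nonneg (pow_nonneg (hf _ _ _) _) (pow_nonneg (hf _ _ _) _)

lemma V_swap (p k l a b : ℕ) : V f p k l b a =
    ∑ r ∈ range (p ^ a), ∑ r' ∈ range (p ^ b), if (p : ℤ) ∣ (r : ℤ) - r' then 0 else
    ∑ ψ, f a r ψ ^ (k * (k + 1) - l * (l + 1)) * f b r' ψ ^ (l * (l + 1)) := by
  unfold V
  rw [sum_comm]
  refine sum_congr rfl fun r _ => sum_congr rfl fun r' _ => ?_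
  exact if_congr dvd_sub_comm rfl (sum_congr rfl fun ψ _ => mul_comm _ _)

lemma holder (hf : ∀ a r ψ, 0 ≤ f a r ψ) {p k l a b : ℕ} (hp : 0 < p) (hl1 : 1 ≤ l) (hlk : l < k)
    {U E1 E2 : ℝ} (hU : 0 < U) (h1 : V f p k (k - l) b a ≤ U * (p : ℝ) ^ E1)
    (h2 : V f p k (l - 1) a b ≤ U * (p : ℝ) ^ E2) :
    V f p k l a b ≤ U * (p : ℝ) ^ (E1 / ((k : ℝ) - l + 1) + E2 * ((k : ℝ) - l) / ((k : ℝ) - l + 1)) := by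
  have hp' : (0 : ℝ) < p := by exact_mod_cast hp
  have hkl : (l : ℝ) < k := by exact_mod_cast hlk
  have hd : (0 : ℝ) < (k : ℝ) - l + 1 := by linarith
  set d : ℝ := (k : ℝ) - l + 1 with hd'
  set α : ℝ := 1 / d with hα
  set β : ℝ := ((k : ℝ) - l) / d with hβ
  have hα0 : 0 ≤ α := by positivity
  have hβ0 : 0 ≤ β := div_nonneg (by linarith) hd.le
  have hαβ : α + β = 1 := by rw [hα, hβ]; field_simp; rw [hd']; ring
  set A := U * (p : ℝ) ^ E1 with hA
  set B := U * (p : ℝ) ^ E2 with hB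
  have hA0 : 0 < A := by positivity
  have hB0 : 0 < B := by positivity
  obtain ⟨e, rfl⟩ := Nat.exists_eq_add_of_lt hlk
  obtain ⟨l, rfl⟩ := Nat.exists_eq_add_of_le' hl1
  have hn1 : (l + 1) * (l + 1 + 1) ≤ (l + 1 + e + 1) * (l + 1 + e + 1 + 1) := by nlinarith
  have hn2 : (e + 1) * (e + 1 + 1) ≤ (l + 1 + e + 1) * (l + 1 + e + 1 + 1) := by nlinarith
  have hn3 : l * (l + 1) ≤ (l + 1 + e + 1) * (l + 1 + e + 1 + 1) := by nlinarith
  have e1 : l + 1 + e + 1 - (l + 1) = e + 1 := by omega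
  have e2 : l + 1 - 1 = l := by omega
  rw [e1] at h1
  rw [e2] at h2
  have hα' : α = 1 / ((e : ℝ) + 2) := by rw [hα, hd']; push_cast; ring_nf
  have hβ' : β = ((e : ℝ) + 1) / ((e : ℝ) + 2) := by rw [hβ, hd']; push_cast; ring_nf
  have key : V f p (l + 1 + e + 1) (l + 1) a b ≤
      A ^ α * B ^ β * (α * (V f p (l + 1 + e + 1) (e + 1) b a / A) +
        β * (V f p (l + 1 + e + 1) l a b / B)) := by
    rw [V_swap p (l + 1 + e + 1) (e + 1) a b]
    unfold V
    simp only [sum_div, mul_sum]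
    rw [← sum_add_distrib, mul_sum]
    refine sum_le_sum fun r _ => ?_
    rw [← sum_add_distrib, mul_sum]
    refine sum_le_sum fun r' _ => ?_
    split_ifs with hc
    · simp
    · simp only [sum_div, mul_sum]
      rw [← sum_add_distrib, mul_sum]
      refine sum_le_sum fun ψ _ => ?_
      refine young (hf _ _ _) (hf _ _ _) hα0 hβ0 hαβ ?_ ?_ hA0 hB0
      · rw [hα', hβ', Nat.cast_sub hn2]; push_cast; field_simp; ring
      · rw [hα', hβ', Nat.cast_sub hn1, Nat.cast_sub hn3]; push_cast; field_simp; ring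
  refine key.trans ?_
  have h3 : α * (V f p (l + 1 + e + 1) (e + 1) b a / A) +
        β * (V f p (l + 1 + e + 1) l a b / B) ≤ 1 := by
    rw [← hαβ]
    refine add_le_add (mul_le_of_le_one_right hα0 ((div_le_one hA0).2 h1))
      (mul_le_of_le_one_right hβ0 ((div_le_one hB0).2 h2))
  refine (mul_le_of_le_one_right (by positivity) h3).trans (le_of_eq ?_)
  rw [hA, hB, Real.mul_rpow hU.le (by positivity), Real.mul_rpow hU.le (by positivity),
    mul_mul_mul_comm, ← Real.rpow_add hU, hαβ, Real.rpow_one, ← Real.rpow_mul hp'.le,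
    ← Real.rpow_mul hp'.le, ← Real.rpow_add hp']
  congr 2
  rw [hα, hβ]; ring

/-- exponent of the target bound -/
def EE (k N : ℕ) (θ : ℝ) (l : ℕ) (a b : ℝ) : ℝ :=
  N * (sg k - 1 + θ) - a * (sg l - 1) - b * (sg k - sg l - 1)

def bet (k : ℕ) (η ε : ℝ) : ℕ → ℕ → ℝ
  | 0, l => if l = 0 then η else -((k : ℝ) + k * sg k + sg k)
  | m + 1, l => if l = 0 then η else
      bet k η ε m (k - l) / l + ((k : ℝ) - l) / ((k : ℝ) - l + 1) * bet k η ε m (l - 1) - ε * k ^ 2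

def GG (k n m : ℕ) : ℕ := n * (k.factorial) ^ (m + 2)

lemma V_base (hf : ∀ a r ψ, 0 ≤ f a r ψ) {p k l a b : ℕ} (hlk : l ≤ k) {A B : ℝ}
    (hA : ∑ r ∈ range (p ^ a), ∑ ψ, f a r ψ ^ (k * (k + 1)) ≤ A)
    (hB : ∑ r ∈ range (p ^ b), ∑ ψ, f b r ψ ^ (k * (k + 1)) ≤ B) :
    V f p k l a b ≤ (p : ℝ) ^ b * A + (p : ℝ) ^ a * B := by
  have hn : l * (l + 1) ≤ k * (k + 1) := Nat.mul_le_mul hlk (by omega)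
  have h1 : V f p k l a b ≤ ∑ r ∈ range (p ^ a), ∑ r' ∈ range (p ^ b),
      (∑ ψ, f a r ψ ^ (k * (k + 1)) + ∑ ψ, f b r' ψ ^ (k * (k + 1))) := by
    unfold V
    refine sum_le_sum fun r _ => sum_le_sum fun r' _ => ?_
    split_ifs
    · exact add_nonneg (sum_nonneg fun ψ _ => pow_nonneg (hf _ _ _) _)
        (sum_nonneg fun ψ _ => pow_nonneg (hf _ _ _) _)
    · rw [← sum_add_distrib]
      refine sum_le_sum fun ψ _ => ?_
      have hx := hf a r ψ
      have hy := hf b r' ψ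
      have e : k * (k + 1) = l * (l + 1) + (k * (k + 1) - l * (l + 1)) := by omega
      rcases le_total (f a r ψ) (f b r' ψ) with h | h
      · calc _ ≤ f b r' ψ ^ (l * (l + 1)) * f b r' ψ ^ (k * (k + 1) - l * (l + 1)) := by gcongr
          _ = f b r' ψ ^ (k * (k + 1)) := by rw [← pow_add, ← e]
          _ ≤ _ := by linarith [pow_nonneg hx (k * (k + 1))]
      · calc _ ≤ f a r ψ ^ (l * (l + 1)) * f a r ψ ^ (k * (k + 1) - l * (l + 1)) := by gcongr
          _ = f a r ψ ^ (k * (k + 1)) := by rw [← pow_add, ← e]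
          _ ≤ _ := by linarith [pow_nonneg hy (k * (k + 1))]
  refine h1.trans ?_
  simp_rw [sum_add_distrib, sum_const, card_range, nsmul_eq_mul, ← mul_sum]
  push_cast
  gcongr

lemma V_zero (hf : ∀ a r ψ, 0 ≤ f a r ψ) {p k a b : ℕ} {B : ℝ}
    (hB : ∑ r ∈ range (p ^ b), ∑ ψ, f b r ψ ^ (k * (k + 1)) ≤ B) :
    V f p k 0 a b ≤ (p : ℝ) ^ a * B := by
  have h1 : V f p k 0 a b ≤ ∑ r ∈ range (p ^ a), ∑ r' ∈ range (p ^ b),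
      (∑ ψ, f b r' ψ ^ (k * (k + 1))) := by
    unfold V
    refine sum_le_sum fun r _ => sum_le_sum fun r' _ => ?_
    split_ifs
    · exact (sum_nonneg fun ψ _ => pow_nonneg (hf _ _ _) _)
    · simp
  refine h1.trans ?_
  simp_rw [sum_const, card_range, nsmul_eq_mul]
  push_cast
  gcongr

end
end TP

namespace TP
open Finset
noncomputable section

variable {Ψ : Type} [Fintype Ψ] {f : ℕ → ℕ → Ψ → ℝ}

lemma dvd_factor {k x M y : ℕ} (h1 : 1 ≤ x) (hx : x ≤ k) (h : M * k.factorial ∣ y) :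
    ∃ t, y = x * t ∧ M ∣ t := by
  obtain ⟨e, rfl⟩ := h
  obtain ⟨g, hg⟩ := Nat.dvd_factorial (by omega : 0 < x) hx
  exact ⟨M * g * e, by rw [hg]; ring, ⟨g * e, by ring⟩⟩

lemma sg_nonneg (l : ℕ) : 0 ≤ sg l := by unfold sg; positivity

lemma sg_ge {l : ℕ} (h : 1 ≤ l) : 1 ≤ sg l := by
  have : (1 : ℝ) ≤ l := by exact_mod_cast h
  unfold sg; nlinarith

lemma sg_mono {l k : ℕ} (h : l ≤ k) : sg l ≤ sg k := by
  have : (l : ℝ) ≤ k := by exact_mod_cast h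
  unfold sg; gcongr

lemma ext_step {p k n N l a0 a1 b : ℕ} {U θ ε β : ℝ} (hp : 2 ≤ p)
    (hstep : ∀ l a b j, 1 ≤ l → l < k → l * n ≤ a → l * (a + j * n) ≤ (k - l + 1) * b →
      a + j * n ≤ N →
      V f p k l a b ≤ (p : ℝ) ^ ((sg l - 1 + ε) * ((j * n : ℕ) : ℝ)) * V f p k l (a + j * n) b)
    (hl1 : 1 ≤ l) (hlk : l < k) (h0 : l * n ≤ a0) (h01 : a0 ≤ a1) (hd0 : n ∣ a0) (hd1 : n ∣ a1)
    (hab : l * a1 = (k - l + 1) * b) (haN : a1 ≤ N)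
    (h : V f p k l a1 b ≤ U * (p : ℝ) ^ (EE k N θ l a1 b - β * b)) :
    V f p k l a0 b ≤ U * (p : ℝ) ^ (EE k N θ l a0 b + ε * ((a1 : ℝ) - a0) - β * b) := by
  obtain ⟨j, hj⟩ := (Nat.dvd_sub hd1 hd0)
  have e : a0 + j * n = a1 := by rw [mul_comm, ← hj]; omega
  have hp' : (0 : ℝ) < p := by exact_mod_cast (by omega : 0 < p)
  have h2 := hstep l a0 b j hl1 hlk h0 (by rw [e, hab]) (by rw [e]; exact haN)
  rw [e] at h2
  refine h2.trans ((mul_le_mul_of_nonneg_left h (by positivity)).trans (le_of_eq ?_))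
  rw [mul_left_comm, ← Real.rpow_add hp']
  congr 2
  have e' : ((j * n : ℕ) : ℝ) = (a1 : ℝ) - a0 := by rw [← e]; push_cast; ring
  rw [e']
  unfold EE
  ring

set_option maxHeartbeats 1000000 in
theorem claim (hf : ∀ a r ψ, 0 ≤ f a r ψ) {p k n N : ℕ} {U θ η ε : ℝ} (hp : 2 ≤ p) (hk : 2 ≤ k)
    (hU : 0 < U) (hη : 0 ≤ η) (hηθ : η ≤ θ) (hε : 0 ≤ ε) (hn : 0 < n)
    (hstep : ∀ l a b j, 1 ≤ l → l < k → l * n ≤ a → l * (a + j * n) ≤ (k - l + 1) * b →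
      a + j * n ≤ N →
      V f p k l a b ≤ (p : ℝ) ^ ((sg l - 1 + ε) * ((j * n : ℕ) : ℝ)) * V f p k l (a + j * n) b)
    (hdec : ∀ b ≤ N, ∑ r ∈ range (p ^ b), ∑ ψ, f b r ψ ^ (k * (k + 1)) ≤
      U / 2 * (p : ℝ) ^ ((sg k - 1 + θ) * ((N : ℝ) - b))) (m : ℕ) :
    ∀ l a b, 1 ≤ l → l < k → l * a = (k - l + 1) * b → GG k n m ∣ b → 0 < b →
      k ^ (m + 1) * b ≤ N →
      V f p k l a b ≤ U * (p : ℝ) ^ (EE k N θ l a b - bet k η ε m l * b) := by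
  have hp1 : (1 : ℝ) ≤ p := by exact_mod_cast (by omega : 1 ≤ p)
  have hp0 : (0 : ℝ) < p := by linarith
  have hab_le : ∀ l a b : ℕ, 1 ≤ l → l < k → l * a = (k - l + 1) * b → a ≤ k * b := by
    intro l a b h1 h2 h3
    calc a ≤ l * a := Nat.le_mul_of_pos_left _ h1
      _ = (k - l + 1) * b := h3
      _ ≤ k * b := Nat.mul_le_mul_right _ (by omega)
  induction m with
  | zero =>
    intro l a b hl1 hlk hab hG hb hbN
    have hak := hab_le l a b hl1 hlk hab
    have haN : a ≤ N := by simpa using hak.trans (by simpa using hbN)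
    have hbk : b ≤ k * b := Nat.le_mul_of_pos_left _ (by omega)
    have hbN' : b ≤ N := hbk.trans (by simpa using hbN)
    refine (V_base hf hlk.le (hdec a haN) (hdec b hbN')).trans ?_
    have hak' : (a : ℝ) ≤ k * b := by exact_mod_cast hak
    have hb' : (0 : ℝ) < b := by exact_mod_cast hb
    have ha' : (0 : ℝ) ≤ a := by positivity
    have hk' : (2 : ℝ) ≤ k := by exact_mod_cast hk
    have hs1 := sg_ge hl1
    have hs2 := sg_mono hlk.le
    have hbet : bet k η ε 0 l = -((k : ℝ) + k * sg k + sg k) := by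
      simp [bet]; omega
    rw [hbet]
    have hE : ∀ x y : ℝ, y ≤ k * b → 0 ≤ x → y + (sg k - 1 + θ) * ((N : ℝ) - x) ≤
        EE k N θ l a b - -((k : ℝ) + k * sg k + sg k) * b := by
      intro x y hy hx
      unfold EE
      have h1 : 0 ≤ (sg k - 1 + θ) * x := mul_nonneg (by linarith) hx
      have h2 : a * (sg l - 1) ≤ k * b * sg k :=
        mul_le_mul hak' (by linarith) (by linarith) (by positivity)
      have h3 : b * (sg k - sg l - 1) ≤ b * sg k :=
        mul_le_mul_of_nonneg_left (by linarith) hb'.le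
      nlinarith
    have h1 : (p : ℝ) ^ b * (U / 2 * (p : ℝ) ^ ((sg k - 1 + θ) * ((N : ℝ) - a))) ≤
        U / 2 * (p : ℝ) ^ (EE k N θ l a b - -((k : ℝ) + k * sg k + sg k) * b) := by
      rw [mul_left_comm, ← Real.rpow_natCast, ← Real.rpow_add hp0]
      refine mul_le_mul_of_nonneg_left (Real.rpow_le_rpow_of_exponent_le hp1 ?_) (by linarith)
      exact hE a b (by nlinarith) ha'
    have h2 : (p : ℝ) ^ a * (U / 2 * (p : ℝ) ^ ((sg k - 1 + θ) * ((N : ℝ) - b))) ≤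
        U / 2 * (p : ℝ) ^ (EE k N θ l a b - -((k : ℝ) + k * sg k + sg k) * b) := by
      rw [mul_left_comm, ← Real.rpow_natCast, ← Real.rpow_add hp0]
      refine mul_le_mul_of_nonneg_left (Real.rpow_le_rpow_of_exponent_le hp1 ?_) (by linarith)
      exact hE b a hak' hb'.le
    linarith
  | succ m ih =>
    intro l a b hl1 hlk hab hG hb hbN
    have hak := hab_le l a b hl1 hlk hab
    have hkpos : 0 < k := by omega
    have hfp : 0 < k.factorial := Nat.factorial_pos k
    have hGG : GG k n (m + 1) = GG k n m * k.factorial := by unfold GG; ring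
    have hGm : n * k.factorial ∣ GG k n m := ⟨k.factorial ^ (m + 1), by unfold GG; ring⟩
    rw [hGG] at hG
    have hGb : GG k n m ∣ b := (Dvd.intro _ rfl).trans hG
    have hGa : GG k n m ∣ a := by
      obtain ⟨t, ht, ht'⟩ := dvd_factor hl1 hlk.le hG
      have : a = (k - l + 1) * t := by
        have : l * a = l * ((k - l + 1) * t) := by rw [hab, ht]; ring
        exact Nat.eq_of_mul_eq_mul_left hl1 this
      rw [this]; exact ht'.mul_left _
    have ha : 0 < a := by
      have : 0 < (k - l + 1) * b := by positivity
      rw [← hab] at this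
      exact Nat.pos_of_mul_pos_left this
    have hdn : n ∣ n * k.factorial := Dvd.intro _ rfl
    have hbig : ∀ x, 0 < x → GG k n m ∣ x → ∀ t ≤ k, t * n ≤ x := by
      intro x hx hd t ht
      have := Nat.le_of_dvd hx (hGm.trans hd)
      calc t * n ≤ k.factorial * n := Nat.mul_le_mul_right _ (ht.trans (Nat.self_le_factorial k))
        _ = n * k.factorial := mul_comm _ _
        _ ≤ x := this
    have hkb1 : k ^ (m + 1) * b ≤ N := by
      refine le_trans (Nat.mul_le_mul_right _ (Nat.pow_le_pow_right hkpos (by omega))) hbN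
    have hka1 : k ^ (m + 1) * a ≤ N := by
      calc k ^ (m + 1) * a ≤ k ^ (m + 1) * (k * b) := Nat.mul_le_mul_left _ hak
        _ = k ^ (m + 1 + 1) * b := by ring
        _ ≤ N := hbN
    have hkk : ∀ x, k * x ≤ k ^ (m + 1) * x := fun x =>
      Nat.mul_le_mul_right _ (by
        calc k = k ^ 1 := (pow_one k).symm
          _ ≤ k ^ (m + 1) := Nat.pow_le_pow_right hkpos (by omega))
    -- first factor
    have hV1 : ∃ a2 : ℕ, a2 ≤ k * a ∧ V f p k (k - l) b a ≤
        U * (p : ℝ) ^ (EE k N θ (k - l) b a + ε * ((a2 : ℝ) - b) - bet k η ε m (k - l) * a) := by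
      obtain ⟨t, ht, ht'⟩ := dvd_factor (x := k - l) (by omega) (by omega) (hGm.trans hGa)
      have h1 : (k - l) * ((l + 1) * t) = (k - (k - l) + 1) * a := by
        rw [ht, show k - (k - l) = l by omega]; ring
      have h2 : b ≤ (l + 1) * t := by
        have h3 : (k - l + 1) * b * (k - l) = l * (k - l) * ((k - l) * t) := by
          rw [← hab, ht]; ring
        obtain ⟨e, he⟩ := Nat.exists_eq_add_of_lt hlk
        have h4 : k - l = e + 1 := by omega
        rw [h4] at h3
        by_contra hcon
        push Not at hcon
        have h5 : (e + 1 + 1) * b = l * ((e + 1) * t) := by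
          have : (e + 1) * ((e + 1 + 1) * b) = (e + 1) * (l * ((e + 1) * t)) := by linarith
          exact Nat.eq_of_mul_eq_mul_left (by omega) this
        nlinarith
      have h3 := hab_le (k - l) ((l + 1) * t) a (by omega) (by omega) h1
      refine ⟨(l + 1) * t, h3, ?_⟩
      refine ext_step hp hstep (by omega) (by omega) (hbig b hb hGb _ (by omega)) h2
        ((hdn.trans hGm).trans hGb) (ht'.mul_left _) h1 (h3.trans ((hkk a).trans hka1)) ?_
      exact ih (k - l) _ a (by omega) (by omega) h1 hGa ha hka1
    have hV2 : ∃ a3 : ℕ, a3 ≤ k * b ∧ a ≤ a3 ∧ V f p k (l - 1) a b ≤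
        U * (p : ℝ) ^ (EE k N θ (l - 1) a b + ε * ((a3 : ℝ) - a) - bet k η ε m (l - 1) * b) := by
      rcases Nat.lt_or_ge 1 l with h | h
      · obtain ⟨t, ht, ht'⟩ := dvd_factor (x := l - 1) (by omega) (by omega) (hGm.trans hGb)
        have h1 : (l - 1) * ((k - l + 2) * t) = (k - (l - 1) + 1) * b := by
          rw [ht, show k - (l - 1) + 1 = k - l + 2 by omega]; ring
        have h2 : a ≤ (k - l + 2) * t := by
          obtain ⟨e, he⟩ := Nat.exists_eq_add_of_lt hlk
          obtain ⟨l', rfl⟩ := Nat.exists_eq_add_of_le' hl1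
          have h4 : k - (l' + 1) = e + 1 := by omega
          rw [h4] at hab ⊢
          have h5 : l' + 1 - 1 = l' := by omega
          rw [h5] at ht
          by_contra hcon
          push Not at hcon
          rw [ht] at hab
          nlinarith
        have h3 := hab_le (l - 1) _ b (by omega) (by omega) h1
        refine ⟨_, h3, h2, ?_⟩
        refine ext_step hp hstep (by omega) (by omega) (hbig a ha hGa _ (by omega)) h2
          ((hdn.trans hGm).trans hGa) (ht'.mul_left _) h1 (h3.trans ((hkk b).trans hkb1)) ?_
        exact ih (l - 1) _ b (by omega) (by omega) h1 hGb hb hkb1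
      · have hl : l = 1 := by omega
        subst hl
        refine ⟨a, hak, le_rfl, ?_⟩
        have hbN' : b ≤ N :=
          (Nat.le_mul_of_pos_left _ (by omega : 0 < k)).trans ((hkk b).trans hkb1)
        refine (V_zero hf (hdec b hbN')).trans ?_
        rw [mul_left_comm, ← Real.rpow_natCast, ← Real.rpow_add hp0]
        refine mul_le_mul (by linarith) (Real.rpow_le_rpow_of_exponent_le hp1 ?_)
          (by positivity) hU.le
        have hbet : bet k η ε m (1 - 1) = η := by cases m <;> simp [bet]
        rw [hbet]
        unfold EE
        have : sg (1 - 1) = 0 := by simp [sg]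
        rw [this]
        have hb' : (0 : ℝ) ≤ b := by positivity
        nlinarith
    obtain ⟨a2, ha2, hV1⟩ := hV1
    obtain ⟨a3, ha3, ha3', hV2⟩ := hV2
    refine (holder hf (by omega) hl1 hlk hU hV1 hV2).trans ?_
    refine mul_le_mul_of_nonneg_left (Real.rpow_le_rpow_of_exponent_le hp1 ?_) hU.le
    have hbet : bet k η ε (m + 1) l = bet k η ε m (k - l) / l +
        ((k : ℝ) - l) / ((k : ℝ) - l + 1) * bet k η ε m (l - 1) - ε * k ^ 2 := by
      simp [bet]; omega
    rw [hbet]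
    have hkl : (l : ℝ) + 1 ≤ k := by exact_mod_cast hlk
    have hl' : (1 : ℝ) ≤ l := by exact_mod_cast hl1
    set d : ℝ := (k : ℝ) - l + 1 with hd
    have hd0 : 0 < d := by linarith
    have habr : (l : ℝ) * a = d * b := by
      have : ((l * a : ℕ) : ℝ) = (((k - l + 1) * b : ℕ) : ℝ) := by rw [hab]
      push_cast [Nat.cast_sub hlk.le] at this
      rw [this, hd]
    have hb' : (0 : ℝ) < b := by exact_mod_cast hb
    have har : (a : ℝ) ≤ k * b := by exact_mod_cast hak
    have ha2r : (a2 : ℝ) ≤ k * a := by exact_mod_cast ha2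
    have ha3r : (a3 : ℝ) ≤ k * b := by exact_mod_cast ha3
    have haa : (0 : ℝ) < a := by exact_mod_cast ha
    set β1 := bet k η ε m (k - l)
    set β2 := bet k η ε m (l - 1)
    have hs1 : sg (k - l) = ((k : ℝ) - l) * ((k : ℝ) - l + 1) / 2 := by
      unfold sg; rw [Nat.cast_sub hlk.le]
    have hs2 : sg (l - 1) = ((l : ℝ) - 1) * l / 2 := by
      unfold sg; rw [Nat.cast_sub hl1]; push_cast; ring
    have hk2 : (2 : ℝ) ≤ k := by exact_mod_cast hk
    have hepsb : (ε * ((a2 : ℝ) - b)) + (ε * ((a3 : ℝ) - a)) * (k - l) ≤ d * (ε * k ^ 2 * b) := by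
      have h0 : (k : ℝ) * a ≤ k * (k * b) := mul_le_mul_of_nonneg_left har (by linarith)
      have h00 : (k : ℝ) * b ≤ k * (k * b) :=
        mul_le_mul_of_nonneg_left (by nlinarith only [hb', hk2]) (by linarith)
      have h1 : (a2 : ℝ) - b ≤ k ^ 2 * b := by linarith only [h0, ha2r, hb']
      have h2 : (a3 : ℝ) - a ≤ k ^ 2 * b := by linarith only [h00, ha3r, haa]
      have h3 : ((a3 : ℝ) - a) * (k - l) ≤ k ^ 2 * b * (k - l) :=
        mul_le_mul_of_nonneg_right h2 (by linarith)
      have h4 : ((a2 : ℝ) - b) + ((a3 : ℝ) - a) * (k - l) ≤ d * (k ^ 2 * b) := by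
        rw [hd]; linarith
      have := mul_le_mul_of_nonneg_left h4 hε
      linarith
    have hfin : (EE k N θ (k - l) b a + ε * ((a2 : ℝ) - b) - β1 * a) / d +
        (EE k N θ (l - 1) a b + ε * ((a3 : ℝ) - a) - β2 * b) * ((k : ℝ) - l) / d =
        EE k N θ l a b - (β1 / l + ((k : ℝ) - l) / d * β2) * b +
        ((ε * ((a2 : ℝ) - b)) + (ε * ((a3 : ℝ) - a)) * (k - l)) / d := by
      have hE : EE k N θ (k - l) b a + EE k N θ (l - 1) a b * (k - l) = d * EE k N θ l a b := by
        unfold EE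
        rw [hs1, hs2]
        unfold sg
        rw [hd]
        ring
      have hβ : β1 * a / d = β1 / l * b := by
        field_simp
        linear_combination β1 * habr
      have : EE k N θ l a b = (EE k N θ (k - l) b a + EE k N θ (l - 1) a b * (k - l)) / d := by
        rw [hE]; field_simp
      rw [this, add_mul (β1 / l), ← hβ]
      ring
    rw [hfin]
    have h5 : ((ε * ((a2 : ℝ) - b)) + (ε * ((a3 : ℝ) - a)) * (k - l)) / d ≤ ε * k ^ 2 * b := by
      rw [div_le_iff₀ hd0]; linarith
    linarith

/-- growth of the exponents -/
lemma bet_sum {k : ℕ} (hk : 2 ≤ k) (η ε : ℝ) (m : ℕ) :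
    ∑ l ∈ Icc 1 (k - 1), bet k η ε (m + 1) l =
      ∑ l ∈ Icc 1 (k - 1), bet k η ε m l + η * ((k : ℝ) - 1) / k - (k - 1) * (ε * k ^ 2) := by
  obtain ⟨K, rfl⟩ := Nat.exists_eq_add_of_le' hk
  have e1 : K + 2 - 1 = K + 1 := by omega
  rw [e1]
  have hI : ∀ g : ℕ → ℝ, ∑ l ∈ Icc 1 (K + 1), g l = ∑ i ∈ range (K + 1), g (i + 1) := by
    intro g
    rw [range_eq_Ico, sum_Ico_add' g 0 (K + 1) 1]
    rfl
  rw [hI, hI]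
  set B := bet (K + 2) η ε m with hB
  have h0 : B 0 = η := by rw [hB]; cases m <;> simp [bet]
  have h1 : ∀ i ∈ range (K + 1), bet (K + 2) η ε (m + 1) (i + 1) =
      B (K + 1 - i) / (i + 1) + ((K : ℝ) + 1 - i) / ((K : ℝ) + 2 - i) * B i - ε * ((K : ℝ) + 2) ^ 2 := by
    intro i hi
    have : K + 2 - (i + 1) = K + 1 - i := by omega
    simp only [bet, this]
    rw [if_neg (by omega)]
    push_cast
    have e3 : (K : ℝ) + 2 - (i + 1) = K + 1 - i := by ring
    have e4 : (K : ℝ) + 1 - i + 1 = K + 2 - i := by ring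
    rw [e3, e4]
  rw [sum_congr rfl h1, sum_sub_distrib, sum_add_distrib]
  have h2 : ∑ i ∈ range (K + 1), B (K + 1 - i) / ((i : ℝ) + 1) =
      ∑ i ∈ range (K + 1), B (i + 1) / ((K : ℝ) + 1 - i) := by
    rw [← sum_range_reflect]
    refine sum_congr rfl fun i hi => ?_
    have hi' : i ≤ K := by simpa [Nat.lt_succ_iff] using hi
    have e5 : K + 1 - 1 - i = K - i := by omega
    have e6 : K + 1 - (K - i) = i + 1 := by omega
    rw [e5, e6, Nat.cast_sub hi']
    congr 1
    ring
  have h3 : ∑ i ∈ range (K + 1), ((K : ℝ) + 1 - i) / ((K : ℝ) + 2 - i) * B i =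
      η * ((K : ℝ) + 1) / (K + 2) +
      ∑ i ∈ range (K + 1), ((K : ℝ) - i) / ((K : ℝ) + 1 - i) * B (i + 1) := by
    rw [sum_range_succ', sum_range_succ]
    rw [h0]
    simp only [sub_self, zero_div, zero_mul, add_zero]
    push_cast
    rw [add_comm]
    congr 1
    · rw [sub_zero, sub_zero]; ring
    · refine sum_congr rfl fun i _ => ?_
      congr 2 <;> ring
  rw [h2, h3, add_left_comm, ← sum_add_distrib]
  have h4 : ∑ x ∈ range (K + 1), (B (x + 1) / ((K : ℝ) + 1 - x) +
      ((K : ℝ) - x) / ((K : ℝ) + 1 - x) * B (x + 1)) = ∑ i ∈ range (K + 1), B (i + 1) := by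
    refine sum_congr rfl fun i hi => ?_
    have hi' : (i : ℝ) ≤ K := by
      exact_mod_cast (by simpa [Nat.lt_succ_iff] using hi : i ≤ K)
    have : (K : ℝ) + 1 - i ≠ 0 := by linarith
    field_simp
    ring
  rw [h4]
  simp only [sum_const, card_range, nsmul_eq_mul]
  push_cast
  ring

lemma bet_large {k : ℕ} (hk : 2 ≤ k) {η : ℝ} (hη : 0 < η) (B : ℝ) :
    ∃ m l, 1 ≤ l ∧ l < k ∧ B ≤ bet k η (η / (4 * k ^ 3)) m l := by
  set ε := η / (4 * (k : ℝ) ^ 3) with hε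
  have hk' : (2 : ℝ) ≤ k := by exact_mod_cast hk
  have hgrow : ∀ m, (∑ l ∈ Icc 1 (k - 1), bet k η ε 0 l) + m * (η / 4) ≤
      ∑ l ∈ Icc 1 (k - 1), bet k η ε m l := by
    intro m
    induction m with
    | zero => simp
    | succ m ih =>
      rw [bet_sum hk]
      have h1 : η * ((k : ℝ) - 1) / k - (k - 1) * (ε * k ^ 2) = (3 / 4) * η * (k - 1) / k := by
        rw [hε]; field_simp; ring
      have h2 : η / 4 ≤ (3 / 4) * η * (k - 1) / k := by
        rw [le_div_iff₀ (by linarith)]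
        nlinarith
      push_cast
      linarith
  obtain ⟨m, hm⟩ := exists_nat_gt ((((k : ℝ) - 1) * |B| - ∑ l ∈ Icc 1 (k - 1), bet k η ε 0 l) / (η / 4))
  rw [div_lt_iff₀ (by positivity)] at hm
  by_contra hcon
  push Not at hcon
  have h1 := hgrow m
  have h2 : ∑ l ∈ Icc 1 (k - 1), bet k η ε m l ≤ ∑ l ∈ Icc 1 (k - 1), |B| := by
    refine sum_le_sum fun l hl => ?_
    simp only [mem_Icc] at hl
    exact (hcon m l hl.1 (by omega)).le.trans (le_abs_self B)
  simp only [sum_const, Nat.card_Icc, nsmul_eq_mul] at h2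
  rw [show k - 1 + 1 - 1 = k - 1 by omega, Nat.cast_sub (by omega)] at h2
  push_cast at h2
  linarith

end
end TP

namespace TP
open Finset
noncomputable section

variable {Q : Type} [AddCommGroup Q]

def fF (k p : ℕ) (q : ℕ → Q) (X : ℤ → ℤ) (c : ℤ → ℂ) (S : Finset ℤ) (a r : ℕ) (ψ : AddChar Q ℂ) : ℝ :=
  ‖F k q X c (cl X (p ^ a) r S) ψ‖

lemma fF_nonneg (k p : ℕ) (q : ℕ → Q) (X : ℤ → ℤ) (c : ℤ → ℂ) (S : Finset ℤ) (a r : ℕ)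
    (ψ : AddChar Q ℂ) : 0 ≤ fF k p q X c S a r ψ := norm_nonneg _

lemma Dec_mono {k p N : ℕ} {D D' : ℝ} (h : Dec k p N D) (hD : D ≤ D') : Dec k p N D' := by
  intro Q _ _ q hq S X c
  refine (h Q q hq S X c).trans (mul_le_mul_of_nonneg_right hD ?_)
  exact sum_nonneg fun r _ => sum_nonneg fun ψ _ => by positivity

lemma V_step {k l p n N a b : ℕ} {D : ℝ} (hp : p.Prime) (hkp : k < p) (hl1 : 1 ≤ l) (hlk : l < k)
    (hn : 0 < n)
    (hD : Dec l p n D) [Finite Q] {q : ℕ → Q} (hq : ND k p (k * N) q)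
    (ha : l * n ≤ a) (hab : l * (a + n) ≤ (k - l + 1) * b) (haN : a + n ≤ N)
    (S : Finset ℤ) (X : ℤ → ℤ) (c : ℤ → ℂ) :
    V (fF k p q X c S) p k l a b ≤ D * V (fF k p q X c S) p k l (a + n) b := by
  have ha1 : 1 ≤ a := le_trans (Nat.mul_pos hl1 hn) ha
  unfold V
  conv_rhs => rw [show range (p ^ (a + n)) = range (p ^ a * p ^ n) by rw [pow_add]]
  rw [sum_range_mul, mul_sum]
  refine sum_le_sum fun r hr => ?_
  rw [sum_comm, mul_sum]
  refine sum_le_sum fun r' _ => ?_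
  have hc : ∀ t : ℕ, (p : ℤ) ∣ ((r + p ^ a * t : ℕ) : ℤ) - r' ↔ (p : ℤ) ∣ (r : ℤ) - r' := by
    intro t
    have : ((r + p ^ a * t : ℕ) : ℤ) - r' = ((r : ℤ) - r') + (p : ℤ) ^ a * t := by push_cast; ring
    rw [this]
    exact dvd_add_left ((dvd_pow_self _ (by omega)).mul_right _)
  simp only [hc]
  split_ifs with hd
  · simp
  · rw [sum_comm]
    exact step hp hkp hl1 hlk hD hq ha hab haN r r' (mem_range.1 hr) hd S X c _

lemma V_steps {k l p n N : ℕ} {D : ℝ} (hD0 : 0 ≤ D) (hp : p.Prime) (hkp : k < p) (hl1 : 1 ≤ l)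
    (hlk : l < k) (hn : 0 < n)
    (hD : Dec l p n D) [Finite Q] {q : ℕ → Q} (hq : ND k p (k * N) q)
    (S : Finset ℤ) (X : ℤ → ℤ) (c : ℤ → ℂ) (b j : ℕ) : ∀ a,
    l * n ≤ a → l * (a + j * n) ≤ (k - l + 1) * b → a + j * n ≤ N →
    V (fF k p q X c S) p k l a b ≤ D ^ j * V (fF k p q X c S) p k l (a + j * n) b := by
  induction j with
  | zero => intro a _ _ _; simp
  | succ j ih =>
    intro a ha hab haN
    have e : a + (j + 1) * n = a + j * n + n := by ring
    rw [e] at hab haN ⊢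
    have h1 := ih a ha ((Nat.mul_le_mul_left _ (by omega)).trans hab) (by omega)
    have h2 := V_step hp hkp hl1 hlk hn hD hq (a := a + j * n) (b := b) (ha.trans (by omega)) hab haN S X c
    refine h1.trans ((mul_le_mul_of_nonneg_left h2 (by positivity)).trans (le_of_eq ?_))
    ring

lemma bn {p : ℕ} (hp : 0 < p) (x : ℕ → ℝ) (hx : ∀ r, 0 ≤ x r) (u v : ℕ) :
    (∑ r ∈ range p, x r) ^ (u + v) ≤ 2 ^ (u + v) * ∑ r ∈ range p, x r ^ (u + v) +
      (p : ℝ) ^ (2 * (u + v)) * ∑ r ∈ range p, ∑ r' ∈ range p,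
        if r = r' then 0 else x r ^ u * x r' ^ v := by
  have hp1 : (1 : ℝ) ≤ p := by exact_mod_cast hp
  have hp0 : (0 : ℝ) < p := by linarith
  obtain ⟨r0, hr0, hmax⟩ := exists_max_image (range p) x ⟨0, by simpa using hp⟩
  have hS1 : 0 ≤ ∑ r ∈ range p, x r ^ (u + v) := sum_nonneg fun r _ => pow_nonneg (hx r) _
  have hin : ∀ r r', 0 ≤ if r = r' then 0 else x r ^ u * x r' ^ v := by
    intro r r'
    split_ifs
    · exact le_rfl
    · exact mul_nonneg (pow_nonneg (hx r) _) (pow_nonneg (hx r') _)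
  have hS2 : 0 ≤ ∑ r ∈ range p, ∑ r' ∈ range p, if r = r' then 0 else x r ^ u * x r' ^ v :=
    sum_nonneg fun r _ => sum_nonneg fun r' _ => hin r r'
  by_cases hcase : ∀ r ∈ range p, r ≠ r0 → p * x r ≤ x r0
  · have h1 : ∑ r ∈ range p, x r ≤ 2 * x r0 := by
      rw [← add_sum_erase _ _ hr0]
      have h2 : ∑ r ∈ (range p).erase r0, x r ≤ ∑ r ∈ (range p).erase r0, x r0 / p := by
        refine sum_le_sum fun r hr => ?_
        rw [mem_erase] at hr
        rw [le_div_iff₀ hp0, mul_comm]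
        exact hcase r hr.2 hr.1
      have h3 : ∑ r ∈ (range p).erase r0, x r0 / p ≤ x r0 := by
        rw [sum_const, nsmul_eq_mul, mul_div_assoc', div_le_iff₀ hp0, mul_comm]
        refine mul_le_mul_of_nonneg_left ?_ (hx r0)
        have := card_erase_le (s := range p) (a := r0)
        rw [card_range] at this
        exact_mod_cast this
      linarith
    have h4 : (∑ r ∈ range p, x r) ^ (u + v) ≤ (2 * x r0) ^ (u + v) :=
      pow_le_pow_left₀ (sum_nonneg fun r _ => hx r) h1 _
    have h5 : x r0 ^ (u + v) ≤ ∑ r ∈ range p, x r ^ (u + v) :=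
      single_le_sum (f := fun r => x r ^ (u + v)) (fun r _ => pow_nonneg (hx r) _) hr0
    rw [mul_pow] at h4
    have h6 := mul_le_mul_of_nonneg_left h5 (by positivity : (0 : ℝ) ≤ 2 ^ (u + v))
    have h7 : 0 ≤ (p : ℝ) ^ (2 * (u + v)) * ∑ r ∈ range p, ∑ r' ∈ range p,
        if r = r' then 0 else x r ^ u * x r' ^ v := mul_nonneg (by positivity) hS2
    linarith
  · push Not at hcase
    obtain ⟨r1, hr1, hne, hlt⟩ := hcase
    have h1 : ∑ r ∈ range p, x r ≤ p * x r0 := by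
      calc ∑ r ∈ range p, x r ≤ ∑ r ∈ range p, x r0 := sum_le_sum hmax
        _ = p * x r0 := by simp
    have h0 := hx r0
    have h00 := hx r1
    have h4 : (∑ r ∈ range p, x r) ^ (u + v) ≤ (p : ℝ) ^ (2 * (u + v)) * (x r0 ^ u * x r1 ^ v) := by
      calc (∑ r ∈ range p, x r) ^ (u + v) ≤ (p * x r0) ^ (u + v) :=
            pow_le_pow_left₀ (sum_nonneg fun r _ => hx r) h1 _
        _ = (p : ℝ) ^ (u + v) * (x r0 ^ u * x r0 ^ v) := by rw [mul_pow, pow_add (x r0)]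
        _ ≤ (p : ℝ) ^ (u + v) * (x r0 ^ u * (p * x r1) ^ v) := by gcongr
        _ = (p : ℝ) ^ (u + v + v) * (x r0 ^ u * x r1 ^ v) := by rw [mul_pow, pow_add _ (u + v)]; ring
        _ ≤ _ := by
          refine mul_le_mul_of_nonneg_right (pow_le_pow_right₀ hp1 (by omega)) (by positivity)
    have h5 : x r0 ^ u * x r1 ^ v ≤ ∑ r ∈ range p, ∑ r' ∈ range p,
        if r = r' then 0 else x r ^ u * x r' ^ v := by
      have h6 : x r0 ^ u * x r1 ^ v = if r0 = r1 then 0 else x r0 ^ u * x r1 ^ v := by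
        rw [if_neg (Ne.symm hne)]
      rw [h6]
      refine le_trans ?_ (single_le_sum (fun r _ => sum_nonneg fun r' _ => hin r r') hr0)
      exact single_le_sum (f := fun r' => if r0 = r' then 0 else x r0 ^ u * x r' ^ v) (fun r' _ => hin r0 r') hr1
    have h6 := mul_le_mul_of_nonneg_left h5 (by positivity : (0 : ℝ) ≤ (p : ℝ) ^ (2 * (u + v)))
    have h7 : 0 ≤ 2 ^ (u + v) * ∑ r ∈ range p, x r ^ (u + v) := by positivity
    linarith

lemma pow_sum_le' (M u : ℕ) (hu : 1 ≤ u) (x : ℕ → ℝ) (hx : ∀ r, 0 ≤ x r) :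
    (∑ t ∈ range M, x t) ^ u ≤ (M : ℝ) ^ u * ∑ t ∈ range M, x t ^ u := by
  rcases Nat.eq_zero_or_pos M with rfl | hM
  · simp [show u ≠ 0 by omega]
  obtain ⟨t0, ht0, hmax⟩ := exists_max_image (range M) x ⟨0, by simpa using hM⟩
  have h1 : ∑ r ∈ range M, x r ≤ M * x t0 := by
    calc ∑ r ∈ range M, x r ≤ ∑ r ∈ range M, x t0 := sum_le_sum hmax
      _ = M * x t0 := by simp
  calc (∑ r ∈ range M, x r) ^ u ≤ (M * x t0) ^ u :=
        pow_le_pow_left₀ (sum_nonneg fun r _ => hx r) h1 _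
    _ = (M : ℝ) ^ u * x t0 ^ u := mul_pow _ _ _
    _ ≤ _ := mul_le_mul_of_nonneg_left
      (single_le_sum (f := fun t => x t ^ u) (fun r _ => pow_nonneg (hx r) _) ht0) (by positivity)

lemma fF_split (k p : ℕ) (hp : 0 < p) (q : ℕ → Q) (X : ℤ → ℤ) (c : ℤ → ℂ) (S : Finset ℤ) (a : ℕ)
    (r : ℕ) (hr : r < p) (ψ : AddChar Q ℂ) (u : ℕ) (hu : 1 ≤ u) :
    fF k p q X c S 1 r ψ ^ u ≤ ((p : ℝ) ^ a) ^ u *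
      ∑ t ∈ range (p ^ a), fF k p q X c S (a + 1) (r + p * t) ψ ^ u := by
  have h1 : fF k p q X c S 1 r ψ ≤ ∑ t ∈ range (p ^ a), fF k p q X c S (a + 1) (r + p * t) ψ := by
    unfold fF
    rw [pow_one, F_split' k q X c p (p ^ a) hp (by positivity) r hr]
    have : p ^ (a + 1) = p * p ^ a := by ring
    rw [this]
    exact norm_sum_le _ _
  refine (pow_le_pow_left₀ (fF_nonneg _ _ _ _ _ _ _ _ _) h1 u).trans ?_
  have := pow_sum_le' (p ^ a) u hu (fun t => fF k p q X c S (a + 1) (r + p * t) ψ)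
    (fun t => fF_nonneg _ _ _ _ _ _ _ _ _)
  push_cast at this
  exact this

lemma V_refine {k l p : ℕ} (hp : 0 < p) (hl1 : 1 ≤ l) (hlk : l < k) [Finite Q] (q : ℕ → Q)
    (S : Finset ℤ) (X : ℤ → ℤ) (c : ℤ → ℂ) (a b : ℕ) :
    V (fF k p q X c S) p k l 1 1 ≤
      (p : ℝ) ^ (a * (k * (k + 1)) + b * (k * (k + 1))) * V (fF k p q X c S) p k l (a + 1) (b + 1) := by
  have hp1 : (1 : ℝ) ≤ p := by exact_mod_cast hp
  set u := l * (l + 1) with hu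
  set w := k * (k + 1) with hw
  have hu1 : 1 ≤ u := Nat.mul_pos hl1 (by omega)
  have huw : u < w := Nat.mul_lt_mul_of_lt_of_le hlk (by omega) (by omega)
  unfold V
  rw [← hu, ← hw, pow_one]
  conv_rhs => rw [show range (p ^ (a + 1)) = range (p * p ^ a) by rw [pow_succ, mul_comm],
    show range (p ^ (b + 1)) = range (p * p ^ b) by rw [pow_succ, mul_comm]]
  rw [sum_range_mul, mul_sum]
  refine sum_le_sum fun r hr => ?_
  simp_rw [sum_range_mul p (p ^ b)]
  rw [sum_comm, mul_sum]
  refine sum_le_sum fun r' hr' => ?_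
  have hc : ∀ t t' : ℕ, (p : ℤ) ∣ ((r + p * t : ℕ) : ℤ) - ((r' + p * t' : ℕ) : ℤ) ↔
      (p : ℤ) ∣ (r : ℤ) - r' := by
    intro t t'
    have : ((r + p * t : ℕ) : ℤ) - ((r' + p * t' : ℕ) : ℤ) = ((r : ℤ) - r') + (p : ℤ) * (t - t') := by
      push_cast; ring
    rw [this]
    exact dvd_add_left (Dvd.intro _ rfl)
  simp only [hc]
  split_ifs with hd
  · simp
  · have hsw : ∑ t ∈ range (p ^ a), ∑ t' ∈ range (p ^ b), ∑ ψ : AddChar Q ℂ,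
        fF k p q X c S (a + 1) (r + p * t) ψ ^ u * fF k p q X c S (b + 1) (r' + p * t') ψ ^ (w - u) =
        ∑ ψ : AddChar Q ℂ, (∑ t ∈ range (p ^ a), fF k p q X c S (a + 1) (r + p * t) ψ ^ u) *
          (∑ t' ∈ range (p ^ b), fF k p q X c S (b + 1) (r' + p * t') ψ ^ (w - u)) := by
      simp_rw [sum_mul_sum]
      rw [sum_comm]
      symm
      rw [sum_comm]
      refine Eq.trans ?_ sum_comm
      refine sum_congr rfl fun t _ => sum_comm
    rw [hsw, mul_sum]
    refine sum_le_sum fun ψ _ => ?_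
    have h1 := fF_split k p hp q X c S a r (mem_range.1 hr) ψ u hu1
    have h2 := fF_split k p hp q X c S b r' (mem_range.1 hr') ψ (w - u) (by omega)
    have hA : 0 ≤ ∑ t ∈ range (p ^ a), fF k p q X c S (a + 1) (r + p * t) ψ ^ u :=
      sum_nonneg fun t _ => pow_nonneg (fF_nonneg _ _ _ _ _ _ _ _ _) _
    have hB : 0 ≤ ∑ t' ∈ range (p ^ b), fF k p q X c S (b + 1) (r' + p * t') ψ ^ (w - u) :=
      sum_nonneg fun t _ => pow_nonneg (fF_nonneg _ _ _ _ _ _ _ _ _) _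
    refine (mul_le_mul h1 h2 (pow_nonneg (fF_nonneg _ _ _ _ _ _ _ _ _) _) (by positivity)).trans ?_
    rw [mul_mul_mul_comm]
    refine mul_le_mul_of_nonneg_right ?_ (mul_nonneg hA hB)
    rw [← pow_mul, ← pow_mul, ← pow_add]
    refine pow_le_pow_right₀ hp1 ?_
    exact add_le_add (Nat.mul_le_mul_left _ huw.le) (Nat.mul_le_mul_left _ (by omega))

lemma broad_narrow {k l p : ℕ} (hp : 0 < p) (hlk : l ≤ k) [Finite Q] (q : ℕ → Q)
    (S : Finset ℤ) (X : ℤ → ℤ) (c : ℤ → ℂ) :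
    ∑ ψ : AddChar Q ℂ, ‖F k q X c S ψ‖ ^ (k * (k + 1)) ≤
      2 ^ (k * (k + 1)) * ∑ r ∈ range (p ^ 1), ∑ ψ : AddChar Q ℂ,
        ‖F k q X c (cl X (p ^ 1) r S) ψ‖ ^ (k * (k + 1)) +
      (p : ℝ) ^ (2 * (k * (k + 1))) * V (fF k p q X c S) p k l 1 1 := by
  have huw : l * (l + 1) ≤ k * (k + 1) := Nat.mul_le_mul hlk (by omega)
  unfold V
  rw [sum_comm (s := range (p ^ 1)) (t := univ)]
  have hV : ∑ r ∈ range (p ^ 1), ∑ r' ∈ range (p ^ 1), (if (p : ℤ) ∣ (r : ℤ) - r' then 0 else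
      ∑ ψ : AddChar Q ℂ, fF k p q X c S 1 r ψ ^ (l * (l + 1)) *
        fF k p q X c S 1 r' ψ ^ (k * (k + 1) - l * (l + 1))) =
      ∑ ψ : AddChar Q ℂ, ∑ r ∈ range (p ^ 1), ∑ r' ∈ range (p ^ 1), (if r = r' then 0 else
      fF k p q X c S 1 r ψ ^ (l * (l + 1)) *
        fF k p q X c S 1 r' ψ ^ (k * (k + 1) - l * (l + 1))) := by
    symm
    rw [sum_comm]
    refine sum_congr rfl fun r hr => ?_
    rw [sum_comm]
    refine sum_congr rfl fun r' hr' => ?_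
    rw [pow_one, mem_range] at hr hr'
    have : (p : ℤ) ∣ (r : ℤ) - r' ↔ r = r' := by
      constructor
      · intro h
        have h2 := Int.eq_zero_of_abs_lt_dvd h (by rw [abs_lt]; constructor <;> omega)
        omega
      · rintro rfl; simp
    simp only [this]
    split_ifs <;> simp
  rw [hV, mul_sum, mul_sum, ← sum_add_distrib]
  refine sum_le_sum fun ψ _ => ?_
  have h1 := bn hp (fun r => fF k p q X c S 1 r ψ) (fun r => fF_nonneg _ _ _ _ _ _ _ _ _)
    (l * (l + 1)) (k * (k + 1) - l * (l + 1))
  rw [Nat.add_sub_cancel' huw] at h1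
  rw [pow_one]
  refine le_trans ?_ (h1.trans (le_of_eq ?_))
  · refine pow_le_pow_left₀ (norm_nonneg _) ?_ _
    rw [F_split k q X c p hp]
    unfold fF
    rw [pow_one]
    exact norm_sum_le _ _
  · unfold fF; simp only [pow_one]

end
end TP

namespace TP
open Finset
noncomputable section

def HP (k p : ℕ) (θ : ℝ) : Prop :=
  ∃ C : ℝ, ∀ N : ℕ, Dec k p N (C * (p : ℝ) ^ ((sg k - 1 + θ) * (N : ℝ)))

lemma HP_mono {k p : ℕ} {θ θ' : ℝ} (hp : 2 ≤ p) (h : HP k p θ) (hθ : θ ≤ θ') : HP k p θ' := by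
  have hp1 : (1 : ℝ) ≤ p := by exact_mod_cast (by omega : 1 ≤ p)
  obtain ⟨C, hC⟩ := h
  refine ⟨max C 0, fun N => Dec_mono (hC N) ?_⟩
  refine mul_le_mul (le_max_left _ _) (Real.rpow_le_rpow_of_exponent_le hp1 ?_) (by positivity)
    (le_max_right _ _)
  exact mul_le_mul_of_nonneg_right (by linarith) (by positivity)

lemma HP_pos {k p : ℕ} {θ : ℝ} (h : HP k p θ) :
    ∃ C : ℝ, 1 ≤ C ∧ ∀ N : ℕ, Dec k p N (C * (p : ℝ) ^ ((sg k - 1 + θ) * (N : ℝ))) := by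
  obtain ⟨C, hC⟩ := h
  refine ⟨max C 1, le_max_right _ _, fun N => Dec_mono (hC N) ?_⟩
  exact mul_le_mul_of_nonneg_right (le_max_left _ _) (by positivity)

lemma choose_n {k p : ℕ} (hp : 2 ≤ p) {ε : ℝ} (hε : 0 < ε)
    (hP : ∀ l, 1 ≤ l → l < k → ∀ ε > 0, HP l p ε) :
    ∃ n, 0 < n ∧ ∀ l, 1 ≤ l → l < k → Dec l p n ((p : ℝ) ^ ((sg l - 1 + ε) * (n : ℝ))) := by
  have hp1 : (1 : ℝ) < p := by exact_mod_cast (by omega : 1 < p)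
  have hp0 : (0 : ℝ) < p := by linarith
  have h1 : ∀ l, ∃ C : ℝ, 1 ≤ C ∧ (1 ≤ l → l < k → ∀ N : ℕ,
      Dec l p N (C * (p : ℝ) ^ ((sg l - 1 + ε / 2) * (N : ℝ)))) := by
    intro l
    by_cases h : 1 ≤ l ∧ l < k
    · obtain ⟨C, hC, h2⟩ := HP_pos (hP l h.1 h.2 (ε / 2) (by positivity))
      exact ⟨C, hC, fun _ _ => h2⟩
    · exact ⟨1, le_rfl, fun h1 h2 => absurd ⟨h1, h2⟩ h⟩
  choose C hC hD using h1
  set M := ∑ l ∈ range k, C l with hM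
  have hy : 1 < (p : ℝ) ^ (ε / 2) := Real.one_lt_rpow hp1 (by positivity)
  obtain ⟨n, hn⟩ := pow_unbounded_of_one_lt M hy
  refine ⟨n + 1, by omega, fun l h1 h2 => Dec_mono (hD l h1 h2 (n + 1)) ?_⟩
  have h3 : C l ≤ M := single_le_sum (f := C) (fun i _ => by linarith [hC i]) (mem_range.2 h2)
  have h4 : C l ≤ ((p : ℝ) ^ (ε / 2)) ^ (n + 1) :=
    h3.trans (hn.le.trans (pow_le_pow_right₀ hy.le (by omega)))
  refine (mul_le_mul_of_nonneg_right h4 (by positivity)).trans (le_of_eq ?_)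
  rw [← Real.rpow_natCast, ← Real.rpow_mul hp0.le, ← Real.rpow_add hp0]
  congr 1
  ring

lemma broad_main {k p n m l : ℕ} {η : ℝ} (hk : 2 ≤ k) (hp : p.Prime) (hkp : k < p) (hη : 0 < η)
    (hn : 0 < n)
    (hD : ∀ l, 1 ≤ l → l < k → Dec l p n ((p : ℝ) ^ ((sg l - 1 + η / (4 * k ^ 3)) * (n : ℝ))))
    (hl1 : 1 ≤ l) (hlk : l < k)
    (hbet : 2 * sg k * (k + 1) + 1 ≤ bet k η (η / (4 * k ^ 3)) m l)
    {κ : ℝ} (hκ : κ * (k : ℝ) ^ (m + 1) ≤ 1) {θ C : ℝ} (hθ : η ≤ θ) (hC1 : 1 ≤ C)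
    (hC : ∀ N : ℕ, Dec k p N (C * (p : ℝ) ^ ((sg k - 1 + θ) * (N : ℝ))))
    {Q : Type} [AddCommGroup Q] [Finite Q] (N : ℕ) (q : ℕ → Q) (hq : ND k p (k * N) q)
    (S : Finset ℤ) (X : ℤ → ℤ) (c : ℤ → ℂ) :
    ∑ ψ : AddChar Q ℂ, ‖F k q X c S ψ‖ ^ (k * (k + 1)) ≤
      2 ^ (k * (k + 1)) * ∑ r ∈ range (p ^ 1), ∑ ψ : AddChar Q ℂ,
        ‖F k q X c (cl X (p ^ 1) r S) ψ‖ ^ (k * (k + 1)) +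
      ((p : ℝ) ^ (2 * (k * (k + 1))) * (2 * C) * (p : ℝ) ^ (GG k n m)) *
        (p : ℝ) ^ ((sg k - 1 + (θ - κ)) * (N : ℝ)) *
        ∑ r ∈ range (p ^ N), ∑ ψ : AddChar Q ℂ,
          ‖F k q X c (cl X (p ^ N) r S) ψ‖ ^ (k * (k + 1)) := by
  have hp2 := hp.two_le
  have hp1 : (1 : ℝ) ≤ p := by exact_mod_cast hp.one_le
  have hp0 : (0 : ℝ) < p := by linarith
  set T := ∑ r ∈ range (p ^ N), ∑ ψ : AddChar Q ℂ,
          ‖F k q X c (cl X (p ^ N) r S) ψ‖ ^ (k * (k + 1)) with hT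
  have hT0 : 0 ≤ T := sum_nonneg fun r _ => sum_nonneg fun ψ _ => by positivity
  have hnar : 0 ≤ 2 ^ (k * (k + 1)) * ∑ r ∈ range (p ^ 1), ∑ ψ : AddChar Q ℂ,
        ‖F k q X c (cl X (p ^ 1) r S) ψ‖ ^ (k * (k + 1)) :=
    mul_nonneg (by positivity) (sum_nonneg fun r _ => sum_nonneg fun ψ _ => by positivity)
  have htriv := hC N Q q hq S X c
  rw [← hT] at htriv
  set G := GG k n m with hG
  have hG0 : 0 < G := by rw [hG, GG]; have := Nat.factorial_pos k; positivity
  set Kk := k ^ (m + 1) with hKk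
  have hKk0 : 0 < Kk := by rw [hKk]; positivity
  have hKr : (k : ℝ) ^ (m + 1) = (Kk : ℝ) := by rw [hKk]; push_cast; rfl
  rw [hKr] at hκ
  have hKr0 : (0 : ℝ) < Kk := by exact_mod_cast hKk0
  set t := N / (Kk * G) with ht
  have hN1 : Kk * (G * t) ≤ N := by
    rw [← mul_assoc]; exact Nat.mul_div_le N (Kk * G)
  have hN2 : N < Kk * (G * t + G) := by
    have := Nat.lt_mul_div_succ N (Nat.mul_pos hKk0 hG0)
    calc N < _ := this
      _ = _ := by rw [← ht]; ring
  have hNb : κ * N ≤ ((G * t : ℕ) : ℝ) + G := by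
    have h1 : (N : ℝ) ≤ Kk * (((G * t : ℕ) : ℝ) + G) := by exact_mod_cast hN2.le
    rcases le_total κ 0 with h | h
    · have : κ * N ≤ 0 := mul_nonpos_of_nonpos_of_nonneg h (by positivity)
      have : (0 : ℝ) ≤ ((G * t : ℕ) : ℝ) + G := by positivity
      linarith
    · calc κ * N ≤ κ * (Kk * (((G * t : ℕ) : ℝ) + G)) := mul_le_mul_of_nonneg_left h1 h
        _ = (κ * Kk) * (((G * t : ℕ) : ℝ) + G) := by ring
        _ ≤ 1 * (((G * t : ℕ) : ℝ) + G) := mul_le_mul_of_nonneg_right hκ (by positivity)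
        _ = _ := one_mul _
  have hbig : 1 ≤ (p : ℝ) ^ (2 * (k * (k + 1))) := one_le_pow₀ hp1
  have hexp : ∀ x : ℝ, x ≤ (sg k - 1 + θ) * N - ((G * t : ℕ) : ℝ) →
      (p : ℝ) ^ x ≤ (p : ℝ) ^ G * (p : ℝ) ^ ((sg k - 1 + (θ - κ)) * (N : ℝ)) := by
    intro x hx
    rw [← Real.rpow_natCast, ← Real.rpow_add hp0]
    refine Real.rpow_le_rpow_of_exponent_le hp1 ?_
    linarith
  rcases Nat.eq_zero_or_pos t with ht0 | ht0
  · have h1 := hexp ((sg k - 1 + θ) * N) (by rw [ht0]; simp)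
    have h2 : C * (p : ℝ) ^ ((sg k - 1 + θ) * (N : ℝ)) * T ≤
        ((p : ℝ) ^ (2 * (k * (k + 1))) * (2 * C) * (p : ℝ) ^ G) *
        (p : ℝ) ^ ((sg k - 1 + (θ - κ)) * (N : ℝ)) * T := by
      refine mul_le_mul_of_nonneg_right ?_ hT0
      rw [mul_assoc ((p : ℝ) ^ (2 * (k * (k + 1))) * (2 * C))]
      refine mul_le_mul ?_ h1 (by positivity) (by positivity)
      nlinarith
    linarith
  rcases hT0.eq_or_lt with hTz | hTpos
  · rw [← hTz] at htriv ⊢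
    linarith
  set b := G * t with hb
  have hb0 : 0 < b := Nat.mul_pos hG0 ht0
  have hGb : G ∣ b := Dvd.intro _ rfl
  obtain ⟨b', hb', -⟩ : ∃ t, b = l * t ∧ 1 ∣ t := by
    refine dvd_factor hl1 hlk.le (M := 1) (dvd_trans ?_ hGb)
    rw [hG, GG, one_mul]
    exact (dvd_pow_self _ (by omega)).mul_left _
  set a := (k - l + 1) * b' with ha
  have hab : l * a = (k - l + 1) * b := by rw [ha, hb']; ring
  have hb'0 : 0 < b' := by
    rcases Nat.eq_zero_or_pos b' with h | h
    · rw [h] at hb'; omega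
    · exact h
  have ha0 : 0 < a := by positivity
  have hak : a ≤ k * b := by
    calc a ≤ l * a := Nat.le_mul_of_pos_left _ hl1
      _ = (k - l + 1) * b := hab
      _ ≤ k * b := Nat.mul_le_mul_right _ (by omega)
  have hcl := claim (f := fF k p q X c S) (fun a r ψ => fF_nonneg _ _ _ _ _ _ _ _ _) (p := p) (k := k)
    (n := n) (N := N)
    (U := 2 * C * T) (θ := θ) (η := η) (ε := η / (4 * k ^ 3)) hp2 hk (by positivity) hη.le hθ
    (by positivity) hn ?_ ?_ m l a b hl1 hlk hab hGb hb0 hN1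
  · have h1 := broad_narrow hp.pos hlk.le q S X c (k := k) (l := l) (p := p)
    have h2 := V_refine hp.pos hl1 hlk q S X c (k := k) (l := l) (p := p) (a - 1) (b - 1)
    rw [Nat.sub_add_cancel ha0, Nat.sub_add_cancel hb0] at h2
    refine h1.trans (add_le_add_right ?_ _)
    have h3 : (p : ℝ) ^ ((a - 1) * (k * (k + 1)) + (b - 1) * (k * (k + 1))) *
        (p : ℝ) ^ (EE k N θ l a b - bet k η (η / (4 * k ^ 3)) m l * b) ≤
        (p : ℝ) ^ G * (p : ℝ) ^ ((sg k - 1 + (θ - κ)) * (N : ℝ)) := by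
      rw [← Real.rpow_natCast, ← Real.rpow_add hp0]
      apply hexp
      have hbr : (0 : ℝ) < b := by exact_mod_cast hb0
      have h4 : (((a - 1) * (k * (k + 1)) + (b - 1) * (k * (k + 1)) : ℕ) : ℝ) ≤
          (k + 1) * b * (2 * sg k) := by
        have : (a - 1) * (k * (k + 1)) + (b - 1) * (k * (k + 1)) ≤ (k + 1) * b * (k * (k + 1)) := by
          rw [← add_mul]
          refine Nat.mul_le_mul_right _ ?_
          have : (k + 1) * b = k * b + b := by ring
          omega
        have h5 : (((k + 1) * b * (k * (k + 1)) : ℕ) : ℝ) = (k + 1) * b * (2 * sg k) := by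
          unfold sg; push_cast; ring
        rw [← h5]
        exact_mod_cast this
      have h5 : (2 * sg k * (k + 1) + 1) * b ≤ bet k η (η / (4 * k ^ 3)) m l * b :=
        mul_le_mul_of_nonneg_right hbet hbr.le
      have h6 : 0 ≤ (a : ℝ) * (sg l - 1) :=
        mul_nonneg (by positivity) (by linarith [sg_ge hl1])
      have h7 : sg l + 1 ≤ sg k := by
        have h8 : (l : ℝ) + 1 ≤ k := by exact_mod_cast hlk
        have h9 : (1 : ℝ) ≤ l := by exact_mod_cast hl1
        unfold sg
        nlinarith
      have h8 : 0 ≤ (b : ℝ) * (sg k - sg l - 1) := mul_nonneg hbr.le (by linarith)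
      unfold EE
      linarith
    have hpb : (0 : ℝ) ≤ (p : ℝ) ^ (2 * (k * (k + 1))) := by positivity
    calc _ ≤ (p : ℝ) ^ (2 * (k * (k + 1))) *
          ((p : ℝ) ^ ((a - 1) * (k * (k + 1)) + (b - 1) * (k * (k + 1))) *
          (2 * C * T * (p : ℝ) ^ (EE k N θ l a b - bet k η (η / (4 * k ^ 3)) m l * b))) := by
          refine mul_le_mul_of_nonneg_left (h2.trans ?_) hpb
          exact mul_le_mul_of_nonneg_left hcl (by positivity)
      _ = (p : ℝ) ^ (2 * (k * (k + 1))) * (2 * C * T) *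
          ((p : ℝ) ^ ((a - 1) * (k * (k + 1)) + (b - 1) * (k * (k + 1))) *
          (p : ℝ) ^ (EE k N θ l a b - bet k η (η / (4 * k ^ 3)) m l * b)) := by ring
      _ ≤ (p : ℝ) ^ (2 * (k * (k + 1))) * (2 * C * T) *
          ((p : ℝ) ^ G * (p : ℝ) ^ ((sg k - 1 + (θ - κ)) * (N : ℝ))) := by
          exact mul_le_mul_of_nonneg_left h3 (by positivity)
      _ = _ := by ring
  · intro l a b j h1 h2 h3 h4 h5
    have h6 := V_steps (by positivity) hp hkp h1 h2 hn (hD l h1 h2) hq S X c b j a h3 h4 h5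
    refine h6.trans (le_of_eq ?_)
    congr 1
    rw [← Real.rpow_natCast, ← Real.rpow_mul hp0.le]
    congr 1
    push_cast
    ring
  · intro b0 hbN
    obtain ⟨e, rfl⟩ := Nat.exists_eq_add_of_le hbN
    have h1 := dec_scale_sum (hC e) hp.pos hq S X c
    refine h1.trans (le_of_eq ?_)
    rw [hT]
    have : ((b0 + e : ℕ) : ℝ) - b0 = e := by push_cast; ring
    rw [this]
    ring

lemma improve {k p : ℕ} {η : ℝ} (hk : 2 ≤ k) (hp : p.Prime) (hkp : k < p) (hp16 : 16 ≤ p)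
    (hη : 0 < η) (hP : ∀ l, 1 ≤ l → l < k → ∀ ε > 0, HP l p ε) :
    ∃ κ : ℝ, 0 < κ ∧ ∀ θ, η ≤ θ → HP k p θ → HP k p (θ - κ) := by
  have hp2 := hp.two_le
  have hp1 : (1 : ℝ) ≤ p := by exact_mod_cast hp.one_le
  have hp0 : (0 : ℝ) < p := by linarith
  have hk0 : (0 : ℝ) < k := by exact_mod_cast (by omega : 0 < k)
  obtain ⟨m, l, hl1, hlk, hbet⟩ := bet_large hk hη (2 * sg k * (k + 1) + 1)
  obtain ⟨n, hn, hD⟩ := choose_n hp2 (ε := η / (4 * k ^ 3)) (by positivity) hP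
  set κ := min (1 / (k : ℝ) ^ (m + 1)) η with hκ
  have hκ1 : κ * (k : ℝ) ^ (m + 1) ≤ 1 := by
    rw [← le_div_iff₀ (by positivity)]; exact min_le_left _ _
  refine ⟨κ, lt_min (by positivity) hη, fun θ hθ hH => ?_⟩
  have hθκ : 0 ≤ θ - κ := by have : κ ≤ η := min_le_right _ _; linarith
  obtain ⟨C, hC1, hC⟩ := HP_pos hH
  set C1 := (p : ℝ) ^ (2 * (k * (k + 1))) * (2 * C) * (p : ℝ) ^ (GG k n m) with hC1d
  have hC10 : 1 ≤ C1 := by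
    have h1 : 1 ≤ (p : ℝ) ^ (2 * (k * (k + 1))) := one_le_pow₀ hp1
    have h2 : 1 ≤ (p : ℝ) ^ (GG k n m) := one_le_pow₀ hp1
    rw [hC1d]
    exact one_le_mul_of_one_le_of_one_le (one_le_mul_of_one_le_of_one_le h1 (by linarith)) h2
  refine ⟨2 * C1, fun N => ?_⟩
  induction N with
  | zero =>
    intro Q _ _ q hq S X c
    have : cl X (p ^ 0) 0 S = S := by
      unfold cl
      refine filter_true_of_mem fun i _ => ?_
      simp
    simp only [pow_zero, range_one, sum_singleton, Nat.cast_zero, mul_zero, Real.rpow_zero, mul_one]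
    rw [pow_zero] at this
    rw [this]
    have hs : 0 ≤ ∑ ψ : AddChar Q ℂ, ‖F k q X c S ψ‖ ^ (k * (k + 1)) :=
      sum_nonneg fun ψ _ => by positivity
    nlinarith
  | succ N ih =>
    intro Q _ _ q hq S X c
    have h1 := broad_main hk hp hkp hη hn hD hl1 hlk hbet hκ1 hθ hC1 hC (N + 1) q hq S X c
    have h2 := dec_scale_sum ih hp.pos (b := 1) (q := q) (by rw [add_comm 1 N]; exact hq) S X c
    rw [add_comm 1 N] at h2
    refine h1.trans ?_
    rw [← hC1d]
    set T := ∑ r ∈ range (p ^ (N + 1)), ∑ ψ : AddChar Q ℂ,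
          ‖F k q X c (cl X (p ^ (N + 1)) r S) ψ‖ ^ (k * (k + 1)) with hT
    have hT0 : 0 ≤ T := sum_nonneg fun r _ => sum_nonneg fun ψ _ => by positivity
    set σ := sg k - 1 + (θ - κ) with hσ
    have hk2 : (2 : ℝ) ≤ k := by exact_mod_cast hk
    have hkey : 2 * 2 ^ (k * (k + 1)) ≤ (p : ℝ) ^ σ := by
      have h3 : (p : ℝ) ^ (sg k - 1) ≤ (p : ℝ) ^ σ :=
        Real.rpow_le_rpow_of_exponent_le hp1 (by linarith)
      have hp16' : (16 : ℝ) ≤ p := by exact_mod_cast hp16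
      have hs : 3 ≤ sg k := by unfold sg; nlinarith
      have h4 : (16 : ℝ) ^ (sg k - 1) ≤ (p : ℝ) ^ (sg k - 1) :=
        Real.rpow_le_rpow (by norm_num) hp16' (by linarith)
      have h5 : (16 : ℝ) ^ (sg k - 1) = 2 ^ (4 * (sg k - 1)) := by
        rw [Real.rpow_mul (by norm_num)]; norm_num
      have h6 : (2 : ℝ) * 2 ^ (k * (k + 1)) = 2 ^ (1 + 2 * sg k) := by
        rw [Real.rpow_add (by norm_num), Real.rpow_one, ← Real.rpow_natCast]
        congr 2
        unfold sg; push_cast; ring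
      have h7 : (2 : ℝ) ^ (1 + 2 * sg k) ≤ 2 ^ (4 * (sg k - 1)) :=
        Real.rpow_le_rpow_of_exponent_le (by norm_num) (by linarith)
      linarith
    have hsplit : (p : ℝ) ^ (σ * ((N + 1 : ℕ) : ℝ)) = (p : ℝ) ^ σ * (p : ℝ) ^ (σ * (N : ℝ)) := by
      rw [← Real.rpow_add hp0]; congr 1; push_cast; ring
    have hpN : 0 < (p : ℝ) ^ (σ * (N : ℝ)) := by positivity
    have h3 : 2 ^ (k * (k + 1)) * (2 * C1 * (p : ℝ) ^ (σ * (N : ℝ)) * T) ≤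
        C1 * (p : ℝ) ^ (σ * ((N + 1 : ℕ) : ℝ)) * T := by
      rw [hsplit]
      have := mul_le_mul_of_nonneg_right hkey
        (by positivity : 0 ≤ C1 * (p : ℝ) ^ (σ * (N : ℝ)) * T)
      linarith
    have h4 := mul_le_mul_of_nonneg_left h2 (by positivity : (0 : ℝ) ≤ 2 ^ (k * (k + 1)))
    linarith

lemma HP_trivial {k p : ℕ} (hk : 1 ≤ k) (hp : 2 ≤ p) : HP k p (sg k + 1) := by
  refine ⟨1, fun N Q _ _ q hq S X c => ?_⟩
  have hp0 : (0 : ℝ) < p := by exact_mod_cast (by omega : 0 < p)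
  rw [sum_comm, mul_sum]
  refine sum_le_sum fun ψ _ => ?_
  rw [F_split k q X c (p ^ N) (by positivity)]
  have h1 := pow_sum_le' (p ^ N) (k * (k + 1)) (Nat.mul_pos hk (by omega))
    (fun r => ‖F k q X c (cl X (p ^ N) r S) ψ‖) (fun r => norm_nonneg _)
  refine (pow_le_pow_left₀ (norm_nonneg _) (norm_sum_le _ _) _).trans (h1.trans (le_of_eq ?_))
  congr 1
  rw [one_mul]
  push_cast
  rw [← pow_mul, ← Real.rpow_natCast]
  congr 1
  unfold sg; push_cast; ring

lemma HP_step {k p : ℕ} (hk : 2 ≤ k) (hp : p.Prime) (hkp : k < p) (hp16 : 16 ≤ p)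
    (hP : ∀ l, 1 ≤ l → l < k → ∀ ε > 0, HP l p ε) (η : ℝ) (hη : 0 < η) : HP k p η := by
  obtain ⟨κ, hκ, h⟩ := improve hk hp hkp hp16 hη hP
  have h1 : ∀ j : ℕ, HP k p (max η (sg k + 1 - j * κ)) := by
    intro j
    induction j with
    | zero => exact HP_mono hp.two_le (HP_trivial (by omega) hp.two_le) (by simp)
    | succ j ih =>
      refine HP_mono hp.two_le (h _ (le_max_left _ _) ih) ?_
      rw [sub_le_iff_le_add, max_le_iff]
      push_cast
      constructor
      · have := le_max_left η (sg k + 1 - (j + 1) * κ); linarith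
      · have := le_max_right η (sg k + 1 - (j + 1) * κ); linarith
  obtain ⟨j, hj⟩ := exists_nat_gt ((sg k + 1) / κ)
  rw [div_lt_iff₀ hκ] at hj
  have := h1 j
  rwa [max_eq_left (by linarith)] at this

end
end TP

namespace TP
open Finset
noncomputable section

variable {Q : Type} [AddCommGroup Q]

lemma orth [Finite Q] {ι κ : Type} (A : Finset ι) (B : Finset κ) (g : ι → Q) (h : κ → Q)
    (c : ι → ℂ) (d : κ → ℂ) [DecidableEq Q] :
    ∑ ψ : AddChar Q ℂ, (∑ i ∈ A, c i * ψ (g i)) * (starRingEnd ℂ) (∑ j ∈ B, d j * ψ (h j)) =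
      (Nat.card Q : ℂ) * ∑ i ∈ A, ∑ j ∈ B, if g i = h j then c i * (starRingEnd ℂ) (d j) else 0 := by
  have := Fintype.ofFinite Q
  have h1 : ∀ ψ : AddChar Q ℂ,
      (∑ i ∈ A, c i * ψ (g i)) * (starRingEnd ℂ) (∑ j ∈ B, d j * ψ (h j)) =
      ∑ i ∈ A, ∑ j ∈ B, c i * (starRingEnd ℂ) (d j) * ψ (g i - h j) := by
    intro ψ
    rw [map_sum, sum_mul_sum]
    refine sum_congr rfl fun i _ => sum_congr rfl fun j _ => ?_
    rw [map_mul, sub_eq_add_neg, AddChar.map_add_eq_mul, AddChar.map_neg_eq_conj]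
    ring
  simp_rw [h1]
  rw [sum_comm, mul_sum]
  refine sum_congr rfl fun i _ => ?_
  rw [sum_comm, mul_sum]
  refine sum_congr rfl fun j _ => ?_
  rw [← mul_sum]
  have h2 := AddChar.sum_apply_eq_ite (g i - h j)
  rw [show ∑ ψ : AddChar Q ℂ, ψ (g i - h j) = _ from by convert h2, Nat.card_eq_fintype_card]
  simp only [sub_eq_zero]
  split_ifs <;> ring

lemma dec_one (p N : ℕ) (hp : 0 < p) : Dec 1 p N 1 := by
  classical
  intro Q _ _ q hq S X c
  have key : ∀ r ∈ range (p ^ N), ∀ r' ∈ range (p ^ N), r ≠ r' →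
      ∑ ψ : AddChar Q ℂ, F 1 q X c (cl X (p ^ N) r S) ψ *
        (starRingEnd ℂ) (F 1 q X c (cl X (p ^ N) r' S) ψ) = 0 := by
    intro r hr r' hr' hne
    unfold F
    rw [orth]
    rw [sum_eq_zero, mul_zero]
    intro i hi
    refine sum_eq_zero fun j hj => ?_
    rw [if_neg]
    intro heq
    apply hne
    have h1 : ∑ j' ∈ Icc 1 1, (fun _ => X i - X j) j' • q j' = 0 := by
      unfold Ph at heq
      simp only [sum_range_succ, range_zero, sum_empty, pow_zero, one_smul, pow_one, zero_add] at heq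
      simp only [Icc_self, sum_singleton]
      rw [sub_smul, sub_eq_zero]
      exact add_left_cancel heq
    have h2 := hq (fun _ => X i - X j) h1 1 (by simp)
    rw [one_mul] at h2
    have h3 := (mem_filter.1 hi).2
    have h4 := (mem_filter.1 hj).2
    have h5 : X j % ((p ^ N : ℕ) : ℤ) = X i % ((p ^ N : ℕ) : ℤ) := by
      apply Int.emod_emod_of_dvd _ (dvd_refl _) |>.symm.trans
      rw [Int.emod_emod_of_dvd _ (dvd_refl _)]
      exact (Int.emod_emod_of_dvd _ (dvd_refl _)).symm.trans (by
        rw [Int.emod_emod_of_dvd _ (dvd_refl _)]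
        exact ((Int.modEq_iff_dvd).2 (by push_cast; exact h2)))
    rw [h3, h4] at h5
    exact_mod_cast h5.symm
  have hC : (∑ ψ : AddChar Q ℂ, (‖F 1 q X c S ψ‖ ^ 2 : ℂ)) =
      ∑ r ∈ range (p ^ N), ∑ ψ : AddChar Q ℂ, (‖F 1 q X c (cl X (p ^ N) r S) ψ‖ ^ 2 : ℂ) := by
    have e : ∀ z : ℂ, (‖z‖ ^ 2 : ℂ) = z * (starRingEnd ℂ) z := fun z => (Complex.mul_conj' z).symm
    simp_rw [e]
    have h1 : ∀ ψ : AddChar Q ℂ, F 1 q X c S ψ * (starRingEnd ℂ) (F 1 q X c S ψ) =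
        ∑ r ∈ range (p ^ N), ∑ r' ∈ range (p ^ N), F 1 q X c (cl X (p ^ N) r S) ψ *
        (starRingEnd ℂ) (F 1 q X c (cl X (p ^ N) r' S) ψ) := by
      intro ψ
      rw [F_split 1 q X c (p ^ N) (by positivity), map_sum, sum_mul_sum]
    simp_rw [h1]
    rw [sum_comm]
    refine sum_congr rfl fun r hr => ?_
    rw [sum_comm, sum_eq_single_of_mem r hr]
    intro r' hr' hne
    exact key r hr r' hr' (Ne.symm hne)
  have hR : (∑ ψ : AddChar Q ℂ, ‖F 1 q X c S ψ‖ ^ 2) =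
      ∑ r ∈ range (p ^ N), ∑ ψ : AddChar Q ℂ, ‖F 1 q X c (cl X (p ^ N) r S) ψ‖ ^ 2 := by
    exact_mod_cast hC
  simp only [one_mul]
  exact le_of_eq hR

theorem HP_all {p : ℕ} (hp : p.Prime) (hp16 : 16 ≤ p) (k : ℕ) : 1 ≤ k → k < p →
    ∀ ε > 0, HP k p ε := by
  induction k using Nat.strong_induction_on with
  | _ k ih =>
    intro hk hkp ε hε
    rcases Nat.lt_or_ge 1 k with h | h
    · exact HP_step h hp hkp hp16 (fun l h1 h2 => ih l h2 h1 (by omega)) ε hε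
    · have : k = 1 := by omega
      subst this
      refine ⟨1, fun N => Dec_mono (dec_one p N hp.pos) ?_⟩
      rw [one_mul]
      refine Real.one_le_rpow (by exact_mod_cast hp.one_le) ?_
      have : sg 1 = 1 := by norm_num [sg]
      rw [this]
      have : (0 : ℝ) ≤ N := by positivity
      nlinarith

end
end TP

namespace TP
open Finset
noncomputable section

lemma collision {ι β : Type} [DecidableEq β] (A : Finset ι) (g : ι → β) :
    ((#A : ℕ) : ℝ) ^ 2 ≤ (#(A.image g) : ℝ) *
      ∑ i ∈ A, ∑ j ∈ A, (if g i = g j then (1 : ℝ) else 0) := by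
  have h1 : ((#A : ℕ) : ℝ) = ∑ b ∈ A.image g, ((#{a ∈ A | g a = b} : ℕ) : ℝ) := by
    exact_mod_cast card_eq_sum_card_image g A
  have h2 : ∑ i ∈ A, ∑ j ∈ A, (if g i = g j then (1 : ℝ) else 0) =
      ∑ b ∈ A.image g, ((#{a ∈ A | g a = b} : ℕ) : ℝ) ^ 2 := by
    rw [← sum_fiberwise_of_maps_to (s := A) (t := A.image g) (g := g)
      (fun i hi => mem_image_of_mem g hi)]
    refine sum_congr rfl fun b _ => ?_
    have : ∀ i ∈ {a ∈ A | g a = b}, ∑ j ∈ A, (if g i = g j then (1 : ℝ) else 0) =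
        ((#{a ∈ A | g a = b} : ℕ) : ℝ) := by
      intro i hi
      rw [(mem_filter.1 hi).2]
      simp [eq_comm]
    rw [sum_congr rfl this, sum_const, nsmul_eq_mul, sq]
  rw [h1, h2]
  exact sq_sum_le_card_mul_sum_sq

lemma char_sum {Q : Type} [AddCommGroup Q] {ι : Type} (ψ : AddChar Q ℂ) (s : Finset ι) (f : ι → Q) :
    ψ (∑ i ∈ s, f i) = ∏ i ∈ s, ψ (f i) := by
  classical
  induction s using Finset.induction_on with
  | empty => simp
  | insert a s ha ih => rw [sum_insert ha, prod_insert ha, AddChar.map_add_eq_mul, ih]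

lemma mean_le {K p N s : ℕ} (hp : 0 < p) (hs : 2 * s = K * (K + 1)) {D : ℝ} (hD0 : 0 ≤ D)
    (hD : Dec K p N D)
    {Q : Type} [AddCommGroup Q] [Finite Q] [DecidableEq Q] (q : ℕ → Q) (hq : ND K p (K * N) q)
    (A : Finset (Fin s → ℤ)) (hA : A = Fintype.piFinset (fun _ => Icc 1 ((p : ℤ) ^ N)))
    (g : (Fin s → ℤ) → Q) (hg : ∀ x, g x = ∑ i, Ph K q (x i)) :
    ∑ x ∈ A, ∑ y ∈ A, (if g x = g y then (1 : ℝ) else 0) ≤ D * (p : ℝ) ^ N := by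
  have := Fintype.ofFinite Q
  have h0 := hD Q q hq (Icc 1 ((p : ℤ) ^ N)) id (fun _ => 1)
  have hcard : (0 : ℝ) < Nat.card Q := by exact_mod_cast Nat.card_pos
  have hpow : ∀ ψ : AddChar Q ℂ, F K q id (fun _ => 1) (Icc 1 ((p : ℤ) ^ N)) ψ ^ s =
      ∑ x ∈ A, 1 * ψ (g x) := by
    intro ψ
    unfold F
    have := Finset.prod_univ_sum (fun _ : Fin s => Icc 1 ((p : ℤ) ^ N))
      (fun _ x => 1 * ψ (Ph K q (id x)))
    rw [prod_const, card_univ, Fintype.card_fin] at this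
    rw [this, hA]
    refine sum_congr rfl fun x _ => ?_
    rw [hg, char_sum, one_mul]
    simp
  have hlhs : ∑ ψ : AddChar Q ℂ, ‖F K q id (fun _ => 1) (Icc 1 ((p : ℤ) ^ N)) ψ‖ ^ (K * (K + 1)) =
      (Nat.card Q : ℝ) * ∑ x ∈ A, ∑ y ∈ A, (if g x = g y then (1 : ℝ) else 0) := by
    have h1 := orth A A g g (fun _ => 1) (fun _ => 1)
    rw [← hs]
    have h2 : ∀ ψ : AddChar Q ℂ, (∑ x ∈ A, 1 * ψ (g x)) * (starRingEnd ℂ) (∑ x ∈ A, 1 * ψ (g x)) =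
        ((‖F K q id (fun _ => 1) (Icc 1 ((p : ℤ) ^ N)) ψ‖ ^ (2 * s) : ℝ) : ℂ) := by
      intro ψ
      rw [← hpow, Complex.mul_conj', norm_pow, mul_comm 2 s, pow_mul]
      push_cast
      rfl
    rw [sum_congr rfl (fun ψ _ => h2 ψ)] at h1
    simp only [map_one, mul_one] at h1
    apply Complex.ofReal_injective
    push_cast at h1 ⊢
    simp only [apply_ite Complex.ofReal, Complex.ofReal_one, Complex.ofReal_zero]
    exact h1
  have hrhs : ∑ r ∈ range (p ^ N), ∑ ψ : AddChar Q ℂ,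
      ‖F K q id (fun _ => 1) (cl id (p ^ N) r (Icc 1 ((p : ℤ) ^ N))) ψ‖ ^ (K * (K + 1)) ≤
      (p : ℝ) ^ N * Nat.card Q := by
    have hb : ∀ r ∈ range (p ^ N), ∑ ψ : AddChar Q ℂ,
      ‖F K q id (fun _ => 1) (cl id (p ^ N) r (Icc 1 ((p : ℤ) ^ N))) ψ‖ ^ (K * (K + 1)) ≤
        (Nat.card Q : ℝ) := by
      intro r _
      have h1 : ∀ ψ ∈ (univ : Finset (AddChar Q ℂ)),
        ‖F K q id (fun _ => 1) (cl id (p ^ N) r (Icc 1 ((p : ℤ) ^ N))) ψ‖ ^ (K * (K + 1)) ≤ 1 := by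
        intro ψ _
        refine pow_le_one₀ (norm_nonneg _) ?_
        unfold F
        refine (norm_sum_le _ _).trans ?_
        have h3 : ∀ i ∈ cl id (p ^ N) r (Icc 1 ((p : ℤ) ^ N)),
            ‖(1 : ℂ) * ψ (Ph K q (id i))‖ = 1 := by
          intro i _
          rw [one_mul, AddChar.norm_apply]
        rw [sum_congr rfl h3, sum_const, nsmul_eq_mul, mul_one]
        have : #(cl id (p ^ N) r (Icc 1 ((p : ℤ) ^ N))) ≤ 1 := by
          rw [card_le_one]
          intro a ha b hb
          simp only [cl, mem_filter, mem_Icc, id, Nat.cast_pow] at ha hb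
          have e : a % (p : ℤ) ^ N = b % (p : ℤ) ^ N := by rw [ha.2, hb.2]
          have e2 : (p : ℤ) ^ N ∣ b - a := Int.modEq_iff_dvd.1 e
          have e3 : b - a = 0 := by
            apply Int.eq_zero_of_abs_lt_dvd e2
            rw [abs_lt]
            constructor <;> linarith [ha.1.1, ha.1.2, hb.1.1, hb.1.2]
          linarith
        exact_mod_cast this
      refine (sum_le_sum h1).trans ?_
      rw [sum_const, card_univ, nsmul_eq_mul, mul_one, Nat.card_eq_fintype_card]
      have h4 := AddChar.card_eq (α := Q)
      apply le_of_eq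
      congr 1
    refine (sum_le_sum hb).trans ?_
    rw [sum_const, card_range, nsmul_eq_mul]
    push_cast
    exact le_rfl
  rw [hlhs] at h0
  have h5 := h0.trans (mul_le_mul_of_nonneg_left hrhs hD0)
  refine le_of_mul_le_mul_left (h5.trans (le_of_eq ?_)) hcard
  ring

lemma count {k p N s : ℕ} (hp : p.Prime) (hs : 2 * s = (k + 1) * (k + 1 + 1)) {D : ℝ} (hD0 : 0 ≤ D)
    (hD : Dec (k + 1) p N D)
    (A : Finset (Fin s → ℤ)) (hA : A = Fintype.piFinset (fun _ => Icc 1 ((p : ℤ) ^ N)))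
    (σ : (Fin s → ℤ) → (Fin k → ℤ) × ℤ)
    (hσ : ∀ x, σ x = (fun j => ∑ i, x i ^ (j.val + 1), ∑ i, x i ^ (k + 1))) :
    (p : ℝ) ^ (2 * s * N) ≤ #(A.image σ) * (D * (p : ℝ) ^ N) := by
  classical
  have hne : NeZero (p ^ ((k + 1) * N)) := ⟨pow_ne_zero _ hp.ne_zero⟩
  let q : ℕ → (Fin (k + 2) → ZMod (p ^ ((k + 1) * N))) := fun j i => if i.val = j then 1 else 0
  have hq : ND (k + 1) p ((k + 1) * N) q := by
    intro n hn j hj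
    rw [mem_Icc] at hj
    have h1 := congrFun hn ⟨j, by omega⟩
    simp only [Finset.sum_apply, Pi.smul_apply, Pi.zero_apply, q] at h1
    rw [sum_eq_single_of_mem j (mem_Icc.2 hj)] at h1
    · simp only [if_true, zsmul_eq_mul, mul_one] at h1
      have := (ZMod.intCast_zmod_eq_zero_iff_dvd _ _).1 h1
      exact_mod_cast this
    · intro b _ hb
      rw [if_neg (Ne.symm hb), smul_zero]
  let g : (Fin s → ℤ) → (Fin (k + 2) → ZMod (p ^ ((k + 1) * N))) := fun x => ∑ i, Ph (k + 1) q (x i)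
  have h1 := mean_le hp.pos hs hD0 hD q hq A hA g (fun _ => rfl)
  have h2 := collision A g
  have h3 : #(A.image g) ≤ #(A.image σ) := by
    let f : (Fin k → ℤ) × ℤ → (Fin (k + 2) → ZMod (p ^ ((k + 1) * N))) := fun v =>
      (∑ j : Fin k, v.1 j • q (j.val + 1)) + (s : ℤ) • q 0 + v.2 • q (k + 1)
    have hf : g = f ∘ σ := by
      funext x
      simp only [g, f, Function.comp, hσ, Ph]
      rw [sum_comm, sum_range_succ, sum_range_succ', ← Fin.sum_univ_eq_sum_range
        (fun j => ∑ i, x i ^ (j + 1) • q (j + 1))]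
      simp_rw [← sum_smul]
      simp
    rw [hf, ← image_image]
    exact card_image_le
  have h4 : ((#A : ℕ) : ℝ) = (p : ℝ) ^ (s * N) := by
    rw [hA, Fintype.card_piFinset]
    simp only [Int.card_Icc, prod_const, card_univ, Fintype.card_fin, add_sub_cancel_right]
    rw [show ((p : ℤ) ^ N).toNat = p ^ N from by
      rw [← Nat.cast_pow, Int.toNat_natCast]]
    push_cast
    rw [← pow_mul, mul_comm]
  rw [h4, ← pow_mul] at h2
  rw [show 2 * s * N = s * N * 2 by ring]
  refine h2.trans (mul_le_mul (by exact_mod_cast h3) h1 ?_ (by positivity))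
  exact sum_nonneg fun i _ => sum_nonneg fun j _ => by split_ifs <;> norm_num

lemma card_P {k p N s G : ℕ} (hp : 0 < p) (hs : 0 < s) (hG : 2 * G = k * (k + 1))
    (T : Finset (Fin k → ℤ))
    (hT : ∀ v ∈ T, ∀ j, 0 ≤ v j ∧ v j ≤ s * (p : ℤ) ^ (N * (j.val + 1))) :
    #T ≤ (2 * s) ^ k * p ^ (N * G) := by
  have h1 : T ⊆ Fintype.piFinset (fun j : Fin k => Icc 0 ((s : ℤ) * (p : ℤ) ^ (N * (j.val + 1)))) := by
    intro v hv
    rw [Fintype.mem_piFinset]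
    intro j
    rw [mem_Icc]
    exact hT v hv j
  refine (card_le_card h1).trans ?_
  rw [Fintype.card_piFinset]
  have h2 : ∀ j ∈ (univ : Finset (Fin k)), #(Icc 0 ((s : ℤ) * (p : ℤ) ^ (N * (j.val + 1)))) ≤
      (2 * s) * p ^ (N * (j.val + 1)) := by
    intro j _
    rw [Int.card_Icc]
    have : 0 < s * p ^ (N * (j.val + 1)) := by positivity
    have e : ((s : ℤ) * (p : ℤ) ^ (N * (j.val + 1)) + 1 - 0) = ((s * p ^ (N * (j.val + 1)) + 1 : ℕ) : ℤ) := by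
      push_cast; ring
    rw [e, Int.toNat_natCast]
    nlinarith
  refine (prod_le_prod' h2).trans (le_of_eq ?_)
  rw [prod_mul_distrib, prod_const, card_univ, Fintype.card_fin, prod_pow_eq_pow_sum, ← mul_sum]
  congr 3
  rw [Fin.sum_univ_eq_sum_range (fun j => j + 1)]
  have h3 := Finset.sum_range_id_mul_two (k + 1)
  rw [sum_range_succ'] at h3
  simp at h3
  nlinarith

theorem main (h k : ℕ) (hk : 3 ≤ k) (s : ℕ) (hs : 2 * s = (k + 1) * (k + 1 + 1)) :
      ∃ x : Fin s → Fin h → ℕ,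
        (∀ i u, 1 ≤ x i u) ∧
        (∀ j ∈ Finset.Icc 1 k, ∀ u v : Fin h, ∑ i, x i u ^ j = ∑ i, x i v ^ j) ∧
        (∀ u v : Fin h, u < v → ∑ i, x i u ^ (k + 1) ≠ ∑ i, x i v ^ (k + 1)) := by
  classical
  obtain ⟨p, hpge, hp⟩ := Nat.exists_infinite_primes (max 16 (k + 2))
  have hp16 : 16 ≤ p := (le_max_left _ _).trans hpge
  have hpk : k + 1 < p := (le_max_right 16 (k + 2)).trans hpge
  obtain ⟨C, hC1, hC⟩ := HP_pos (HP_all hp hp16 (k + 1) (by omega) hpk 1 one_pos)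
  have hs0 : 0 < s := by
    rcases Nat.eq_zero_or_pos s with h0 | h0
    · subst h0; simp at hs
    · exact h0
  let σ : (Fin s → ℤ) → (Fin k → ℤ) × ℤ :=
    fun x => (fun j => ∑ i, x i ^ (j.val + 1), ∑ i, x i ^ (k + 1))
  let A : ℕ → Finset (Fin s → ℤ) := fun N => Fintype.piFinset (fun _ => Icc 1 ((p : ℤ) ^ N))
  have key : ∃ N, ∃ b, h < #{a ∈ (A N).image σ | a.1 = b} := by
    by_contra hcon
    push Not at hcon
    obtain ⟨G, hG⟩ : ∃ G, 2 * G = k * (k + 1) := by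
      obtain ⟨G, hG⟩ := (Nat.even_mul_succ_self k).two_dvd
      exact ⟨G, hG.symm⟩
    have hsG : s = G + (k + 1) := by nlinarith
    obtain ⟨N, hN⟩ := pow_unbounded_of_one_lt ((h : ℝ) * (2 * s) ^ k * C)
      (show (1 : ℝ) < p by exact_mod_cast hp.one_lt)
    have hppos : (0 : ℝ) < p := by exact_mod_cast hp.pos
    have hexp : (p : ℝ) ^ ((sg (k + 1) - 1 + 1) * (N : ℝ)) = (p : ℝ) ^ (s * N) := by
      rw [← Real.rpow_natCast]
      congr 1
      have : (2 : ℝ) * s = (k + 1) * (k + 1 + 1) := by exact_mod_cast hs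
      push_cast
      unfold sg
      push_cast
      rw [← this]; ring
    have h1 := count hp hs (by positivity) (hC N) (A N) rfl σ (fun _ => rfl)
    rw [hexp] at h1
    have h2 := card_le_mul_card_image (f := Prod.fst) ((A N).image σ) h (fun b _ => hcon N b)
    have h3 : #(((A N).image σ).image Prod.fst) ≤ (2 * s) ^ k * p ^ (N * G) := by
      apply card_P hp.pos hs0 hG
      intro v hv j
      simp only [mem_image, exists_exists_and_eq_and] at hv
      obtain ⟨x, hx, rfl⟩ := hv
      have hx' : ∀ i, 1 ≤ x i ∧ x i ≤ (p : ℤ) ^ N := fun i =>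
        mem_Icc.1 (Fintype.mem_piFinset.1 hx i)
      simp only [σ]
      constructor
      · exact sum_nonneg fun i _ => pow_nonneg (by linarith [(hx' i).1]) _
      · have : ∀ i ∈ (univ : Finset (Fin s)), x i ^ (j.val + 1) ≤ (p : ℤ) ^ (N * (j.val + 1)) := by
          intro i _
          rw [pow_mul]
          exact pow_le_pow_left₀ (by linarith [(hx' i).1]) (hx' i).2 _
        refine (sum_le_sum this).trans ?_
        simp
    have h4 : (#((A N).image σ) : ℝ) ≤ h * ((2 * s) ^ k * p ^ (N * G)) := by
      exact_mod_cast h2.trans (Nat.mul_le_mul_left _ h3)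
    have h5 : (p : ℝ) ^ (2 * s * N) ≤
        h * ((2 * s) ^ k * p ^ (N * G)) * (C * (p : ℝ) ^ (s * N) * (p : ℝ) ^ N) :=
      h1.trans (mul_le_mul_of_nonneg_right h4 (by positivity))
    have h6 : (h : ℝ) * ((2 * s) ^ k * p ^ (N * G)) * (C * (p : ℝ) ^ (s * N) * (p : ℝ) ^ N) =
        (h : ℝ) * (2 * s) ^ k * C * (p : ℝ) ^ (N * G + s * N + N) := by
      rw [pow_add, pow_add]; ring
    have h7 : (p : ℝ) ^ (2 * s * N) = (p : ℝ) ^ (k * N) * (p : ℝ) ^ (N * G + s * N + N) := by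
      rw [← pow_add]
      congr 1
      rw [hsG]; ring
    rw [h6, h7] at h5
    have h8 := le_of_mul_le_mul_right h5 (by positivity)
    have h9 : (p : ℝ) ^ N ≤ (p : ℝ) ^ (k * N) :=
      pow_le_pow_right₀ (by exact_mod_cast hp.one_le) (Nat.le_mul_of_pos_left _ (by omega))
    linarith
  obtain ⟨N, b, hb⟩ := key
  obtain ⟨T, hT, hTc⟩ := exists_subset_card_eq hb.le
  let e := (T.equivFinOfCardEq hTc).symm
  have hm : ∀ u : Fin h, ∃ x ∈ A N, σ x = (e u).1 ∧ (σ x).1 = b := by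
    intro u
    have := mem_filter.1 (hT (e u).2)
    obtain ⟨x, hx, hxe⟩ := mem_image.1 this.1
    exact ⟨x, hx, hxe, by rw [hxe]; exact this.2⟩
  choose y hyA hye hyb using hm
  have hy1 : ∀ u i, 1 ≤ y u i := fun u i => (mem_Icc.1 (Fintype.mem_piFinset.1 (hyA u) i)).1
  have hcast : ∀ u j, ((∑ i, (y u i).toNat ^ j : ℕ) : ℤ) = ∑ i, y u i ^ j := by
    intro u j
    rw [Nat.cast_sum]
    refine sum_congr rfl fun i _ => ?_
    rw [Nat.cast_pow, Int.toNat_of_nonneg (by linarith [hy1 u i])]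
  refine ⟨fun i u => (y u i).toNat, ?_, ?_, ?_⟩
  · intro i u
    have := hy1 u i
    show 1 ≤ (y u i).toNat
    omega
  · intro j hj u v
    rw [mem_Icc] at hj
    apply Int.ofNat_injective
    show ((∑ i, (y u i).toNat ^ j : ℕ) : ℤ) = ((∑ i, (y v i).toNat ^ j : ℕ) : ℤ)
    rw [hcast, hcast]
    have := congrFun ((hyb u).trans (hyb v).symm) ⟨j - 1, by omega⟩
    simp only [σ] at this
    rwa [Nat.sub_add_cancel hj.1] at this
  · intro u v huv heq
    have h1 : ((∑ i, (y u i).toNat ^ (k + 1) : ℕ) : ℤ) = ((∑ i, (y v i).toNat ^ (k + 1) : ℕ) : ℤ) := by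
      exact congrArg _ heq
    rw [hcast, hcast] at h1
    have h2 : σ (y u) = σ (y v) := Prod.ext ((hyb u).trans (hyb v).symm) h1
    rw [hye, hye] at h2
    exact huv.ne (e.injective (Subtype.ext h2))

end
end TP

theorem tarry_problem (h k : ℕ) (hh : 2 ≤ h) (hk : 3 ≤ k) :
    ∃ s : ℕ, (s : ℝ) ≤ 5 / 8 * ((k : ℝ) + 1) ^ 2 ∧
      ∃ x : Fin s → Fin h → ℕ,
        (∀ i u, 1 ≤ x i u) ∧
        (∀ j ∈ Finset.Icc 1 k, ∀ u v : Fin h, ∑ i, x i u ^ j = ∑ i, x i v ^ j) ∧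
        (∀ u v : Fin h, u < v → ∑ i, x i u ^ (k + 1) ≠ ∑ i, x i v ^ (k + 1)) := by
  obtain ⟨s, hs⟩ := (Nat.even_mul_succ_self (k + 1)).two_dvd
  refine ⟨s, ?_, TP.main h k hk s hs.symm⟩
  have h1 : (2 : ℝ) * s = (k + 1) * (k + 1 + 1) := by exact_mod_cast hs.symm
  have h2 : (3 : ℝ) ≤ k := by exact_mod_cast hk
  nlinarith
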